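/- arXiv:2303.01953 — 4 statements merged into one kernel-verified Lean document; each statement's English description precedes it below -/
import Mathlib

section
/- Let q be an odd prime power and j ∈ {1,…,q} with j ≠ (q+1)/2. (i) Every line ℓ of PG(3,q²) with |ℓ ∩ Q⁺(3,q²)| = 2 and |ℓ ∩ O| = 1 satisfies |ℓ ∩ (S_j \ O)| = (q−1)/2. (ii) Every line ℓ of PG(3,q²) with |ℓ ∩ Q⁺(3,q²)| = 1 and |ℓ ∩ O| = 1 satisfies |ℓ ∩ (S_j \ O)| = 0. -/
noncomputable section

open Matrix

/-- The points of `PG(3,q²)`: the projectivization of `F⁴` where `F = 𝔽_{q²}`. -/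
abbrev PGPoint (F : Type*) [Field F] := Projectivization F (Fin 4 → F)

/-- The form `F_γ(X₁,X₂,X₃,X₄) = X₁^q X₄ + X₁ X₄^q − X₂^{q+1} − X₃^{q+1}
    − γ (X₁X₄ − X₂X₃)^{(q+1)/2}`. -/
def Fgam {F : Type*} [Field F] (q : ℕ) (γ : F) (x : Fin 4 → F) : F :=
  x 0 ^ q * x 3 + x 0 * x 3 ^ q - x 1 ^ (q + 1) - x 2 ^ (q + 1)
    - γ * (x 0 * x 3 - x 1 * x 2) ^ ((q + 1) / 2)

/-- The point set `C_γ` of `PG(3,q²)`, the zero locus of `F_γ`. -/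
def Cgam {F : Type*} [Field F] (q : ℕ) (γ : F) : Set (PGPoint F) :=
  {P | ∀ (v : Fin 4 → F) (hv : v ≠ 0), P = Projectivization.mk F v hv → Fgam q γ v = 0}

/-- Kronecker product of two 2×2 matrices, as a 4×4 matrix. -/
def kron {F : Type*} [Field F] (A B : Matrix (Fin 2) (Fin 2) F) :
    Matrix (Fin 4) (Fin 4) F :=
  Matrix.of fun i j =>
    A ⟨i.val / 2, by have := i.isLt; omega⟩ ⟨j.val / 2, by have := j.isLt; omega⟩ *
    B ⟨i.val % 2, by have := i.isLt; omega⟩ ⟨j.val % 2, by have := j.isLt; omega⟩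

/-- Entrywise `q`-th power (the matrix `A^q`). -/
def matq {F : Type*} [Field F] (q : ℕ) (A : Matrix (Fin 2) (Fin 2) F) :
    Matrix (Fin 2) (Fin 2) F :=
  A.map (· ^ q)

/-- The orbit of a point of `PG(3,q²)` under the group `K ≅ PSL(2,q²)` of projectivities
    induced by the matrices `A^q ⊗ A` with `A ∈ SL(2,𝔽_{q²})`. -/
def Korb {F : Type*} [Field F] (q : ℕ) (P : PGPoint F) : Set (PGPoint F) :=
  {P' | ∃ A : Matrix (Fin 2) (Fin 2) F, A.det = 1 ∧
    ∃ (v : Fin 4 → F) (hv : v ≠ 0) (hw : Matrix.vecMul v (kron (matq q A) A) ≠ 0),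
      P = Projectivization.mk F v hv ∧ P' = Projectivization.mk F _ hw}

/-- The orbit of a point of `PG(3,q²)` under the group `G ≅ PGL(2,q²)` of projectivities
    induced by the matrices `A^q ⊗ A` with `A ∈ GL(2,𝔽_{q²})`. -/
def Gorb {F : Type*} [Field F] (q : ℕ) (P : PGPoint F) : Set (PGPoint F) :=
  {P' | ∃ A : Matrix (Fin 2) (Fin 2) F, A.det ≠ 0 ∧
    ∃ (v : Fin 4 → F) (hv : v ≠ 0) (hw : Matrix.vecMul v (kron (matq q A) A) ≠ 0),
      P = Projectivization.mk F v hv ∧ P' = Projectivization.mk F _ hw}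

/-- The Hermitian Veronese curve `O = {(1,t,t^q,t^{q+1})} ∪ {(0,0,0,1)}`. -/
def Oset (F : Type*) [Field F] (q : ℕ) : Set (PGPoint F) :=
  {P | (∃ (t : F) (hv : ![1, t, t ^ q, t ^ (q + 1)] ≠ 0),
        P = Projectivization.mk F _ hv) ∨
    ∃ (hv : (![0, 0, 0, 1] : Fin 4 → F) ≠ 0), P = Projectivization.mk F _ hv}

/-- The Baer subgeometry `Σ = {(a,b,b^q,c) : a,c ∈ 𝔽_q, b ∈ 𝔽_{q²}}`. -/
def SigmaSet (F : Type*) [Field F] (q : ℕ) : Set (PGPoint F) :=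
  {P | ∃ (a b c : F) (hv : ![a, b, b ^ q, c] ≠ 0),
    a ^ q = a ∧ c ^ q = c ∧ P = Projectivization.mk F _ hv}

/-- The hyperbolic quadric `Q⁺(3,q²) : X₁X₄ − X₂X₃ = 0`. -/
def Qplus (F : Type*) [Field F] : Set (PGPoint F) :=
  {P | ∀ (v : Fin 4 → F) (hv : v ≠ 0), P = Projectivization.mk F v hv →
    v 0 * v 3 - v 1 * v 2 = 0}

/-- A line of `PG(3,q²)`: the set of points lying in a 2-dimensional subspace. -/
def IsLine {F : Type*} [Field F] (ℓ : Set (PGPoint F)) : Prop :=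
  ∃ W : Submodule F (Fin 4 → F), Module.finrank F W = 2 ∧ ℓ = {P | P.rep ∈ W}

/-- A plane of `PG(3,q²)`: the set of points lying in a 3-dimensional subspace. -/
def IsPlane {F : Type*} [Field F] (π : Set (PGPoint F)) : Prop :=
  ∃ W : Submodule F (Fin 4 → F), Module.finrank F W = 3 ∧ π = {P | P.rep ∈ W}

/-- In a field with `q²` elements, `q` a power of a prime, `x ↦ x ^ q` is an involutive ring
endomorphism. -/
lemma exists_ringHom_pow {F : Type*} [Field F] [Fintype F] {p n : ℕ} (hp : p.Prime)
    (hF : Fintype.card F = (p ^ n) ^ 2) :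
    ∃ σ : F →+* F, (∀ x, σ x = x ^ (p ^ n)) ∧ ∀ x, σ (σ x) = x := by
  have hchar : CharP F p := by
    obtain ⟨r, hr⟩ := CharP.exists F
    obtain ⟨m, hrp, hm⟩ := FiniteField.card F r
    have : r ∣ p := by
      have h : r ∣ (p ^ n) ^ 2 := by
        rw [← hF, hm]; exact dvd_pow_self r m.ne_zero
      exact hrp.dvd_of_dvd_pow (hrp.dvd_of_dvd_pow h)
    rwa [(Nat.prime_dvd_prime_iff_eq hrp hp).1 this] at hr
  have : Fact p.Prime := ⟨hp⟩
  refine ⟨iterateFrobenius F p n, fun x => iterateFrobenius_def p n x, fun x => ?_⟩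
  rw [iterateFrobenius_def, iterateFrobenius_def, ← pow_mul, ← sq, ← hF, FiniteField.pow_card]

/-- A generator of the multiplicative group of a finite field is a primitive root of unity. -/
lemma isPrimitiveRoot_of_forall_exists_pow {F : Type*} [Field F] [Fintype F] {ξ : F}
    (hξ0 : ξ ≠ 0) (hξ : ∀ x : F, x ≠ 0 → ∃ m : ℕ, x = ξ ^ m) :
    IsPrimitiveRoot ξ (Fintype.card F - 1) := by
  classical
  rw [IsPrimitiveRoot.iff_orderOf]
  have h := orderOf_eq_card_of_forall_mem_zpowers (g := Units.mk0 ξ hξ0) (by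
    intro x
    obtain ⟨m, hm⟩ := hξ x x.ne_zero
    exact ⟨m, by ext; simp [hm]⟩)
  rw [← orderOf_units, Units.val_mk0, Nat.card_eq_fintype_card, Fintype.card_units] at h
  exact h

/-- If `-1` is an `n`-th power of a field containing a primitive `n`-th root of unity, it has
exactly `n` such roots. -/
lemma card_filter_pow_eq_neg_one {F : Type*} [Field F] [Fintype F] [DecidableEq F] {n : ℕ}
    (hn : 0 < n) {ζ α : F} (hζ : IsPrimitiveRoot ζ n) (hα : α ^ n = -1) :
    (Finset.univ.filter fun x : F => x ^ n = -1).card = n := by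
  have h1 := hζ.card_nthRoots (-1)
  rw [if_pos ⟨α, hα⟩] at h1
  have h2 := hζ.nthRoots_nodup (a := (-1 : F)) (by simp)
  rw [← Multiset.toFinset_card_of_nodup h2] at h1
  refine Eq.trans (congrArg Finset.card ?_) h1
  ext x
  simp [Polynomial.mem_nthRoots hn]

section Count

variable {F : Type*} [Field F] [Fintype F] {σ : F →+* F} {k : ℕ} {κ u N : F}

lemma card_filter_mul_eq [DecidableEq F] (hσσ : ∀ x, σ (σ x) = x) (hσ : ∀ x, σ x = x ^ (2 * k + 1))
    (hk : 0 < k) (hκ : κ ≠ 0) (hu : u ^ 2 ≠ 1) (huκ : u = κ ^ k) (hσN : σ N = N) (hN : N ≠ 0) :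
    (Finset.univ.filter fun m : F => κ * (m - u ^ 2 * σ m) * (m - σ m) = N).card =
      (Finset.univ.filter fun x : F => x ^ (2 * k) = -1).card := by
  have hu0 : u ≠ 0 := by rw [huκ]; exact pow_ne_zero _ hκ
  have hκσ : σ κ = κ * u ^ 2 := by rw [hσ, huκ]; ring
  have huσ : σ u ^ 2 * u ^ 2 = 1 := by
    have h := hσσ κ
    rw [hκσ, map_mul, hκσ, map_pow] at h
    apply mul_left_cancel₀ hκ
    linear_combination h
  have hd : 1 - u ^ 2 ≠ 0 := sub_ne_zero.2 (Ne.symm hu)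
  have hd' : 1 - σ u ^ 2 ≠ 0 := by
    intro h
    apply hu
    linear_combination u ^ 2 * h + huσ
  have hinv : ∀ B : F, B ^ (2 * k) = -1 → B ≠ 0 ∧
      σ ((N / (κ * B) - u ^ 2 * B) / (1 - u ^ 2)) = (N / (κ * B) - B) / (1 - u ^ 2) := by
    intro B hB
    have hB0 : B ≠ 0 := by
      rintro rfl; rw [zero_pow (by omega)] at hB; simp at hB
    have hσB : σ B = -B := by rw [hσ, pow_succ, hB]; ring
    have hu' : σ u ^ 2 = (u ^ 2)⁻¹ := eq_inv_of_mul_eq_one_left huσ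
    refine ⟨hB0, ?_⟩
    simp only [map_div₀, map_sub, map_mul, map_pow, map_one, hσN, hκσ, hσB]
    rw [div_eq_div_iff hd' hd, hu']
    field_simp
    ring
  refine Finset.card_nbij' (fun m => m - σ m) (fun B => (N / (κ * B) - u ^ 2 * B) / (1 - u ^ 2))
    ?_ ?_ ?_ ?_
  · intro m hm
    simp only [Finset.coe_filter, Finset.mem_univ, true_and, Set.mem_ofPred_eq] at hm ⊢
    have hB : m - σ m ≠ 0 := by
      intro h; rw [h, mul_zero] at hm; exact hN hm.symm
    apply mul_right_cancel₀ hB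
    rw [← pow_succ, ← hσ, map_sub, hσσ]; ring
  · intro B hB
    simp only [Finset.coe_filter, Finset.mem_univ, true_and, Set.mem_ofPred_eq] at hB ⊢
    obtain ⟨hB0, e⟩ := hinv B hB
    rw [e]
    field_simp
    ring
  · intro m hm
    simp only [Finset.coe_filter, Finset.mem_univ, true_and, Set.mem_ofPred_eq] at hm ⊢
    have hB : m - σ m ≠ 0 := by
      intro h; rw [h, mul_zero] at hm; exact hN hm.symm
    rw [← hm]
    field_simp
    ring
  · intro B hB
    simp only [Finset.coe_filter, Finset.mem_univ, true_and, Set.mem_ofPred_eq] at hB ⊢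
    obtain ⟨hB0, e⟩ := hinv B hB
    rw [e]
    field_simp
    ring

/-- Every solution of the equation is `κ` times a square. -/
lemma exists_eq_mul_sq (hσσ : ∀ x, σ (σ x) = x) (hσ : ∀ x, σ x = x ^ (2 * k + 1))
    (hF : Fintype.card F = (2 * k + 1) ^ 2) (hκ : κ ≠ 0)
    (hu : u ^ 4 ≠ 1) (huκ : u = κ ^ k) (hσN : σ N = N) {l : F} (hl : l ≠ 0)
    (h : l + σ l - (u + u⁻¹) * l ^ (k + 1) = N) : ∃ m, l = κ * m ^ 2 := by
  have hu0 : u ≠ 0 := by rw [huκ]; exact pow_ne_zero _ hκ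
  have hodd : Fintype.card F = 2 * (2 * k * (k + 1)) + 1 := by rw [hF]; ring
  have h2 : ringChar F ≠ 2 := by
    intro h
    have := FiniteField.even_card_of_char_two h
    omega
  have hhalf : Fintype.card F / 2 = 2 * k * (k + 1) := by omega
  have hγ : u + u⁻¹ ≠ 0 := by
    intro h0
    apply hu
    field_simp at h0
    linear_combination (u ^ 2 - 1) * h0
  have hT : σ ((u + u⁻¹) * l ^ (k + 1)) = (u + u⁻¹) * l ^ (k + 1) := by
    rw [show (u + u⁻¹) * l ^ (k + 1) = l + σ l - N by linear_combination -h]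
    rw [map_sub, map_add, hσσ, hσN]; ring
  have he : (u ^ (2 * k + 2)) ^ 2 = 1 := by
    have := FiniteField.pow_card_sub_one_eq_one κ hκ
    rw [hodd] at this
    rw [huκ, ← this]
    simp only [← pow_mul]
    congr 1
    simp only [Nat.add_sub_cancel]; ring
  have huσ : σ u = u ^ (2 * k + 2) * u⁻¹ := by
    rw [hσ]; field_simp; ring
  have hσγ : σ (u + u⁻¹) = u ^ (2 * k + 2) * (u + u⁻¹) := by
    rw [map_add, map_inv₀, huσ]
    have h0 : u ^ (2 * k + 2) ≠ 0 := pow_ne_zero _ hu0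
    field_simp
    linear_combination -u ^ 2 * he
  have hsq : IsSquare (l * κ) := by
    rw [FiniteField.isSquare_iff h2 (mul_ne_zero hl hκ), hhalf]
    rw [map_mul, hσγ, hσ] at hT
    apply mul_left_cancel₀ (mul_ne_zero hγ (pow_ne_zero (k + 1) hl))
    rw [huκ] at hT ⊢
    rw [mul_one]
    refine Eq.trans ?_ hT
    ring
  obtain ⟨s, hs⟩ := hsq
  refine ⟨s / κ, ?_⟩
  field_simp
  linear_combination hs

lemma card_filter_add_sub_eq [DecidableEq F] (hσσ : ∀ x, σ (σ x) = x) (hσ : ∀ x, σ x = x ^ (2 * k + 1))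
    (hF : Fintype.card F = (2 * k + 1) ^ 2) (hk : 0 < k) {ξ : F}
    (hξ : IsPrimitiveRoot ξ (Fintype.card F - 1)) (hκ : κ ≠ 0)
    (hu : u ^ 4 ≠ 1) (huκ : u = κ ^ k) (hσN : σ N = N) (hN : N ≠ 0) :
    (Finset.univ.filter fun l : F => l + σ l - (u + u⁻¹) * l ^ (k + 1) = N).card = k := by
  have hu0 : u ≠ 0 := by rw [huκ]; exact pow_ne_zero _ hκ
  have hu2 : u ^ 2 ≠ 1 := fun h => hu (by linear_combination (u ^ 2 + 1) * h)
  have hcard : Fintype.card F - 1 = 2 * (k + 1) * (2 * k) := by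
    rw [hF]; have : (2 * k + 1) ^ 2 = 2 * (k + 1) * (2 * k) + 1 := by ring
    omega
  have h2 : (2 : F) ≠ 0 := by
    have h2 : ringChar F ≠ 2 := by
      intro h
      have := FiniteField.even_card_of_char_two h
      rw [hF, ← Nat.even_iff, Nat.even_pow] at this
      exact Nat.not_even_two_mul_add_one k this.1
    exact Ring.two_ne_zero h2
  have hpos : 0 < Fintype.card F - 1 := by rw [hcard]; positivity
  have hζ : IsPrimitiveRoot (ξ ^ (2 * (k + 1))) (2 * k) := hξ.pow hpos hcard
  have hα : (ξ ^ (k + 1)) ^ (2 * k) = -1 := by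
    have h1 := hξ.pow_eq_one
    have h3 : ξ ^ ((k + 1) * (2 * k)) ≠ 1 :=
      hξ.pow_ne_one_of_pos_of_lt (by positivity) (by rw [hcard]; nlinarith)
    rw [← pow_mul]
    refine (mul_self_eq_one_iff.1 ?_).resolve_left h3
    rw [← h1, ← pow_add, hcard]; congr 1; ring
  have hM := (card_filter_mul_eq hσσ hσ hk hκ hu2 huκ hσN hN).trans
    (card_filter_pow_eq_neg_one (by omega) hζ hα)
  have key : ∀ m : F, κ * m ^ 2 + σ (κ * m ^ 2) - (u + u⁻¹) * (κ * m ^ 2) ^ (k + 1) =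
      κ * (m - u ^ 2 * σ m) * (m - σ m) := by
    intro m
    have e1 : σ (κ * m ^ 2) = κ * u ^ 2 * σ m ^ 2 := by
      rw [map_mul, map_pow, hσ κ, huκ]; ring
    have e2 : (κ * m ^ 2) ^ (k + 1) = κ * u * (m * σ m) := by
      rw [hσ m, huκ]; ring
    rw [e1, e2]
    field_simp
    ring
  have hfib := Finset.card_eq_sum_card_fiberwise
    (s := Finset.univ.filter fun m : F => κ * (m - u ^ 2 * σ m) * (m - σ m) = N)
    (t := Finset.univ.filter fun l : F => l + σ l - (u + u⁻¹) * l ^ (k + 1) = N)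
    (f := fun m => κ * m ^ 2) (by
      intro m hm
      simp only [Finset.coe_filter, Finset.mem_univ, true_and, Set.mem_ofPred_eq] at hm ⊢
      rw [key, hm])
  rw [hM, Finset.sum_const_nat (m := 2)] at hfib
  · omega
  intro l hl
  simp only [Finset.mem_filter, Finset.mem_univ, true_and] at hl
  have hl0 : l ≠ 0 := by
    rintro rfl
    apply hN
    rw [← hl]; simp
  obtain ⟨m, rfl⟩ := exists_eq_mul_sq hσσ hσ hF hκ hu huκ hσN hl0 hl
  have hm0 : m ≠ 0 := by rintro rfl; simp at hl0
  have hne : m ≠ -m := by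
    intro h
    apply mul_ne_zero h2 hm0
    linear_combination h
  refine Eq.trans (congrArg Finset.card ?_) (Finset.card_pair hne)
  ext y
  simp only [Finset.mem_filter, Finset.mem_univ, true_and, Finset.mem_insert,
    Finset.mem_singleton]
  rw [← sq_eq_sq_iff_eq_or_eq_neg]
  constructor
  · rintro ⟨-, h⟩
    exact mul_left_cancel₀ hκ h
  · intro h
    refine ⟨?_, by rw [h]⟩
    rw [← key, h, hl]

end Count

/-- The quadratic form of the hyperbolic quadric. -/
def quadForm {F : Type*} [Field F] (v : Fin 4 → F) : F := v 0 * v 3 - v 1 * v 2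

/-- The polar form of `quadForm`. -/
def quadPolar {F : Type*} [Field F] (v w : Fin 4 → F) : F :=
  v 0 * w 3 + v 3 * w 0 - v 1 * w 2 - v 2 * w 1

/-- The Hermitian part of `Fgam`. -/
def hermForm {F : Type*} [Field F] (σ : F →+* F) (v : Fin 4 → F) : F :=
  σ (v 0) * v 3 + v 0 * σ (v 3) - v 1 * σ (v 1) - v 2 * σ (v 2)

/-- The normalized coordinate vectors of the points of `O`. -/
def IsVeronese {F : Type*} [Field F] (σ : F →+* F) (v : Fin 4 → F) : Prop :=
  (∃ t, v = ![1, t, σ t, t * σ t]) ∨ v = ![0, 0, 0, 1]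

section Forms

variable {F : Type*} [Field F] {σ : F →+* F} {v w : Fin 4 → F}

lemma quadForm_smul (c : F) (v : Fin 4 → F) : quadForm (c • v) = c ^ 2 * quadForm v := by
  simp only [quadForm, Pi.smul_apply, smul_eq_mul]; ring

lemma quadPolar_smul_right (c : F) (v w : Fin 4 → F) :
    quadPolar v (c • w) = c * quadPolar v w := by
  simp only [quadPolar, Pi.smul_apply, smul_eq_mul]; ring

lemma quadPolar_add_right (v w x : Fin 4 → F) :
    quadPolar v (w + x) = quadPolar v w + quadPolar v x := by
  simp only [quadPolar, Pi.add_apply]; ring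

lemma hermForm_smul (c : F) (v : Fin 4 → F) : hermForm σ (c • v) = c * σ c * hermForm σ v := by
  simp only [hermForm, Pi.smul_apply, smul_eq_mul, map_mul]; ring

lemma map_hermForm (hσσ : ∀ x, σ (σ x) = x) (v : Fin 4 → F) :
    σ (hermForm σ v) = hermForm σ v := by
  simp only [hermForm, map_sub, map_add, map_mul, hσσ]; ring

lemma IsVeronese.ne_zero (h : IsVeronese σ v) : v ≠ 0 := by
  rintro rfl
  rcases h with ⟨t, h⟩ | h
  · simpa using congrFun h 0
  · simpa using congrFun h 3

lemma IsVeronese.quadForm_eq_zero (h : IsVeronese σ v) : quadForm v = 0 := by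
  rcases h with ⟨t, rfl⟩ | rfl <;> simp [quadForm]

lemma IsVeronese.quadPolar_self (h : IsVeronese σ v) : quadPolar v v = 0 := by
  have h2 : quadPolar v v = 2 * quadForm v := by simp only [quadPolar, quadForm]; ring
  rw [h2, h.quadForm_eq_zero, mul_zero]

lemma IsVeronese.quadForm_add_smul (h : IsVeronese σ v) (w : Fin 4 → F) (l : F) :
    quadForm (w + l • v) = quadForm w + l * quadPolar v w := by
  have h2 : quadForm (w + l • v) = quadForm w + l * quadPolar v w + l ^ 2 * quadForm v := by
    simp only [quadPolar, quadForm, Pi.add_apply, Pi.smul_apply, smul_eq_mul]; ring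
  rw [h2, h.quadForm_eq_zero, mul_zero, add_zero]

lemma IsVeronese.hermForm_add_smul (hσσ : ∀ x, σ (σ x) = x) (h : IsVeronese σ v)
    (w : Fin 4 → F) (l : F) :
    hermForm σ (w + l • v) =
      hermForm σ w + l * σ (quadPolar v w) + σ l * quadPolar v w := by
  rcases h with ⟨t, rfl⟩ | rfl
  · simp [hermForm, quadPolar, hσσ]; ring
  · simp [hermForm, quadPolar]; ring

/-- A vector which is singular for both forms is proportional to a vector of `O`. -/
lemma exists_isVeronese_smul_eq (hσσ : ∀ x, σ (σ x) = x)
    (hD : quadForm w = 0) (hH : hermForm σ w = 0) :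
    ∃ (v : Fin 4 → F) (c : F), IsVeronese σ v ∧ w = c • v := by
  simp only [quadForm] at hD
  simp only [hermForm] at hH
  by_cases h0 : w 0 = 0
  · refine ⟨_, w 3, Or.inr rfl, ?_⟩
    simp only [h0, map_zero, zero_mul, zero_sub, zero_add, neg_eq_zero, mul_eq_zero] at hD hH
    have h12 : w 1 = 0 ∧ w 2 = 0 := by
      rcases hD with h | h <;> simp [h] at hH <;> exact ⟨by assumption, by assumption⟩
    ext i
    fin_cases i <;> simp [h0, h12.1, h12.2]
  · have hσ0 : σ (w 0) ≠ 0 := (map_ne_zero σ).2 h0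
    have hσD : σ (w 0) * σ (w 3) - σ (w 1) * σ (w 2) = 0 := by
      rw [← map_mul, ← map_mul, ← map_sub, hD, map_zero]
    have hprod : (w 0 * σ (w 1) - w 2 * σ (w 0)) * (w 0 * σ (w 2) - w 1 * σ (w 0)) = 0 := by
      linear_combination w 0 * σ (w 0) * hH - σ (w 0) ^ 2 * hD - w 0 ^ 2 * hσD
    have h2 : w 0 * σ (w 1) - w 2 * σ (w 0) = 0 := by
      rcases mul_eq_zero.1 hprod with h | h
      · exact h
      · have h' := congrArg σ h
        simp only [map_sub, map_mul, hσσ, map_zero] at h'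
        linear_combination -h'
    refine ⟨_, w 0, Or.inl ⟨w 1 / w 0, rfl⟩, ?_⟩
    ext i
    fin_cases i
    · simp
    · simp; field_simp
    · simp; field_simp; linear_combination -h2
    · simp; field_simp
      apply mul_left_cancel₀ h0
      linear_combination σ (w 0) * hD - w 1 * h2

lemma IsVeronese.hermForm_ne_of_quadPolar_eq_zero [Fintype F] {k : ℕ} {u : F}
    (hσσ : ∀ x, σ (σ x) = x) (hσ : ∀ x, σ x = x ^ (2 * k + 1))
    (hF : Fintype.card F = (2 * k + 1) ^ 2) (hu : u ^ 4 ≠ 1) (hu' : u ^ (4 * (k + 1)) = 1)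
    (h : IsVeronese σ v) (hp : quadPolar v w = 0) (hD : quadForm w ≠ 0) :
    hermForm σ w ≠ (u + u⁻¹) * quadForm w ^ (k + 1) := by
  have hu0 : u ≠ 0 := by
    rintro rfl; simp at hu'
  obtain ⟨a, b, e1, e2⟩ : ∃ a b, quadForm w = -(a * b) ∧ hermForm σ w = -(a * σ a + b * σ b) := by
    rcases h with ⟨t, rfl⟩ | rfl
    · refine ⟨w 1 - t * w 0, w 2 - σ t * w 0, ?_, ?_⟩
      · simp [quadPolar] at hp
        simp only [quadForm]
        linear_combination w 0 * hp
      · have hp' := congrArg σ hp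
        simp [quadPolar, hσσ] at hp hp'
        simp only [hermForm, map_sub, map_mul, hσσ]
        linear_combination σ (w 0) * hp + w 0 * hp'
    · refine ⟨w 1, w 2, ?_, ?_⟩ <;> simp [quadPolar] at hp <;> simp [quadForm, hermForm, hp]
      ring
  rw [e1, e2]
  rw [e1] at hD
  have ha : a ≠ 0 := by rintro rfl; simp at hD
  have hb : b ≠ 0 := by rintro rfl; simp at hD
  intro hE
  have hs : ((-1 : F) ^ k) ^ 2 = 1 := by rw [← pow_mul, mul_comm, pow_mul]; simp
  have hE' : (a ^ (k + 1)) ^ 2 + (b ^ (k + 1)) ^ 2 =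
      (-1) ^ k * (u + u⁻¹) * (a ^ (k + 1) * b ^ (k + 1)) := by
    rw [hσ, hσ, neg_pow, mul_pow, pow_succ (-1 : F)] at hE
    linear_combination -hE
  have hpow : ∀ c : F, c ≠ 0 → (c ^ (k + 1)) ^ (4 * k) = 1 := by
    intro c hc
    rw [← FiniteField.pow_card_sub_one_eq_one c hc, ← pow_mul, hF]
    congr 1
    apply (Nat.sub_eq_of_eq_add _).symm
    ring
  have hs' : ((-1 : F) ^ k) ^ (4 * k) = 1 := by
    rw [show 4 * k = 2 * (2 * k) by ring, pow_mul, hs, one_pow]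
  have hprod : (a ^ (k + 1) - (-1) ^ k * u * b ^ (k + 1)) *
      (u * a ^ (k + 1) - (-1) ^ k * b ^ (k + 1)) = 0 := by
    field_simp at hE'
    linear_combination hE' + u * (b ^ (k + 1)) ^ 2 * hs
  have hk : u ^ (4 * k) = 1 := by
    rcases mul_eq_zero.1 hprod with h | h
    · have h' := congrArg (· ^ (4 * k)) (sub_eq_zero.1 h)
      simpa [mul_pow, hpow a ha, hpow b hb, hs'] using h'.symm
    · have h' := congrArg (· ^ (4 * k)) (sub_eq_zero.1 h)
      simpa [mul_pow, hpow a ha, hpow b hb, hs'] using h'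
  apply hu
  rw [mul_add, pow_add, hk] at hu'
  simpa using hu'

end Forms

section Points

variable {F : Type*} [Field F] {σ : F →+* F} {k : ℕ}

lemma Fgam_eq (hσ : ∀ x, σ x = x ^ (2 * k + 1)) (γ : F) (v : Fin 4 → F) :
    Fgam (2 * k + 1) γ v = hermForm σ v - γ * quadForm v ^ (k + 1) := by
  have h : (2 * k + 1 + 1) / 2 = k + 1 := by omega
  simp only [Fgam, hermForm, quadForm, h, hσ]
  ring

lemma mk_mem_Qplus {v : Fin 4 → F} (hv : v ≠ 0) :
    Projectivization.mk F v hv ∈ Qplus F ↔ quadForm v = 0 := by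
  refine ⟨fun h => h v hv rfl, fun h w hw e => ?_⟩
  obtain ⟨c, rfl⟩ := (Projectivization.mk_eq_mk_iff' F v w hv hw).1 e
  rw [quadForm_smul] at h
  have hc : c ≠ 0 := by rintro rfl; simp at hv
  exact (mul_eq_zero.1 h).resolve_left (pow_ne_zero 2 hc)

lemma mk_mem_Cgam (hσ : ∀ x, σ x = x ^ (2 * k + 1)) {γ : F} {v : Fin 4 → F} (hv : v ≠ 0) :
    Projectivization.mk F v hv ∈ Cgam (2 * k + 1) γ ↔
      hermForm σ v = γ * quadForm v ^ (k + 1) := by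
  rw [← sub_eq_zero, ← Fgam_eq hσ]
  refine ⟨fun h => h v hv rfl, fun h w hw e => ?_⟩
  obtain ⟨c, rfl⟩ := (Projectivization.mk_eq_mk_iff' F v w hv hw).1 e
  have hc : c ≠ 0 := by rintro rfl; simp at hv
  have h' : c ^ (2 * k + 2) * Fgam (2 * k + 1) γ w = 0 := by
    rw [← h, Fgam_eq hσ, Fgam_eq hσ, quadForm_smul, hermForm_smul, hσ]
    ring
  exact (mul_eq_zero.1 h').resolve_left (pow_ne_zero _ hc)

lemma mem_Oset_iff (hσ : ∀ x, σ x = x ^ (2 * k + 1)) {P : PGPoint F} :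
    P ∈ Oset F (2 * k + 1) ↔
      ∃ (v : Fin 4 → F) (hv : v ≠ 0), IsVeronese σ v ∧ P = Projectivization.mk F v hv := by
  have e : ∀ t : F, ![1, t, t ^ (2 * k + 1), t ^ (2 * k + 1 + 1)] = ![1, t, σ t, t * σ t] := by
    intro t; rw [hσ, pow_succ' t (2 * k + 1)]
  constructor
  · rintro (⟨t, hv, h⟩ | ⟨hv, h⟩)
    · exact ⟨_, hv, Or.inl ⟨t, e t⟩, h⟩
    · exact ⟨_, hv, Or.inr rfl, h⟩
  · rintro ⟨v, hv, ⟨t, h⟩ | h, hP⟩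
    · rw [← e t] at h
      subst h
      exact Or.inl ⟨t, hv, hP⟩
    · subst h
      exact Or.inr ⟨hv, hP⟩

lemma mk_rep_mem_iff {W : Submodule F (Fin 4 → F)} {v : Fin 4 → F} (hv : v ≠ 0) :
    (Projectivization.mk F v hv).rep ∈ W ↔ v ∈ W := by
  obtain ⟨a, ha⟩ := Projectivization.exists_smul_eq_mk_rep F v hv
  rw [← ha]
  exact W.smul_mem_iff' a

lemma eq_span_pair {W : Submodule F (Fin 4 → F)} (hW : Module.finrank F W = 2)
    {v w : Fin 4 → F} (hv : v ≠ 0) (hvW : v ∈ W) (hwW : w ∈ W) (h : ∀ a : F, a • v ≠ w) :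
    W = Submodule.span F {v, w} := by
  symm
  apply Submodule.eq_of_le_of_finrank_eq
  · rw [Submodule.span_le]
    rintro x (rfl | rfl) <;> assumption
  · have hli := (LinearIndependent.pair_iff' (K := F) hv).2 h
    have := finrank_span_eq_card hli
    rw [Matrix.range_cons, Matrix.range_cons, Matrix.range_empty, Set.union_empty,
      Set.singleton_union] at this
    rw [hW, this, Fintype.card_fin]

end Points

section Lines

variable {F : Type*} [Field F] [Fintype F] {σ : F →+* F} {k : ℕ}
  {W : Submodule F (Fin 4 → F)} {v : Fin 4 → F} {hv : v ≠ 0}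

lemma ncard_secant (hσσ : ∀ x, σ (σ x) = x) (hσ : ∀ x, σ x = x ^ (2 * k + 1))
    (hF : Fintype.card F = (2 * k + 1) ^ 2) (hk : 0 < k) {ξ : F}
    (hξ : IsPrimitiveRoot ξ (Fintype.card F - 1)) {κ u : F} (hκ : κ ≠ 0)
    (hu : u ^ 4 ≠ 1) (huκ : u = κ ^ k)
    (hW : Module.finrank F W = 2) (hV : IsVeronese σ v)
    (hO : {P : PGPoint F | P.rep ∈ W} ∩ Oset F (2 * k + 1) = {Projectivization.mk F v hv})
    (hQ : ({P : PGPoint F | P.rep ∈ W} ∩ Qplus F).ncard = 2) :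
    ({P : PGPoint F | P.rep ∈ W} ∩ (Cgam (2 * k + 1) (u + u⁻¹) \ Oset F (2 * k + 1))).ncard
      = k := by
  classical
  have hmemO : ∀ P : PGPoint F, P.rep ∈ W →
      (P ∈ Oset F (2 * k + 1) ↔ P = Projectivization.mk F v hv) := by
    intro P hP
    rw [← Set.mem_singleton_iff, ← hO]
    exact ⟨fun h => ⟨hP, h⟩, fun h => h.2⟩
  have hvW : v ∈ W := by
    have h : Projectivization.mk F v hv ∈ ({Projectivization.mk F v hv} : Set (PGPoint F)) := rfl
    rw [← hO] at h
    exact (mk_rep_mem_iff hv).1 h.1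
  have hPQ : Projectivization.mk F v hv ∈ {P : PGPoint F | P.rep ∈ W} ∩ Qplus F :=
    ⟨(mk_rep_mem_iff hv).2 hvW, (mk_mem_Qplus hv).2 hV.quadForm_eq_zero⟩
  obtain ⟨R, ⟨hRW, hRQ⟩, hRP⟩ := Set.exists_ne_of_one_lt_ncard (by rw [hQ]; norm_num)
    (Projectivization.mk F v hv)
  induction R using Projectivization.ind with | _ w₀ hw₀ => ?_
  have hw₀W : w₀ ∈ W := (mk_rep_mem_iff hw₀).1 hRW
  have hw₀D : quadForm w₀ = 0 := (mk_mem_Qplus hw₀).1 hRQ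
  have hindep : ∀ a : F, a • v ≠ w₀ := fun a ha =>
    hRP ((Projectivization.mk_eq_mk_iff' F _ _ hw₀ hv).2 ⟨a, ha⟩)
  have hb : quadPolar v w₀ ≠ 0 := by
    intro hb
    have hne : w₀ + (1 : F) • v ≠ 0 := by
      intro h
      apply hindep (-1)
      rw [one_smul] at h
      rw [neg_one_smul, neg_eq_of_add_eq_zero_left h]
    have hmem : Projectivization.mk F _ hne ∈ {P : PGPoint F | P.rep ∈ W} ∩ Qplus F := by
      refine ⟨(mk_rep_mem_iff hne).2 (W.add_mem hw₀W (W.smul_mem _ hvW)), ?_⟩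
      rw [mk_mem_Qplus, hV.quadForm_add_smul, hw₀D, hb]
      ring
    have h3 : ({Projectivization.mk F v hv, Projectivization.mk F w₀ hw₀,
        Projectivization.mk F _ hne} : Set (PGPoint F)).ncard = 3 := by
      rw [Set.ncard_eq_three]
      refine ⟨_, _, _, hRP.symm, ?_, ?_, rfl⟩
      · intro h
        obtain ⟨a, ha⟩ := (Projectivization.mk_eq_mk_iff' F _ _ hne hv).1 h.symm
        apply hindep (a - 1)
        rw [sub_smul, ha]
        simp
      · intro h
        obtain ⟨a, ha⟩ := (Projectivization.mk_eq_mk_iff' F _ _ hne hw₀).1 h.symm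
        have h1 : a - 1 ≠ 0 := by
          intro h1
          rw [sub_eq_zero.1 h1] at ha
          simp at ha
          exact hv ha
        apply hindep (a - 1)⁻¹
        rw [inv_smul_eq_iff₀ h1, sub_smul, ha]
        simp
    have hle := Set.ncard_le_ncard (t := {P : PGPoint F | P.rep ∈ W} ∩ Qplus F)
      (Set.insert_subset hPQ (Set.insert_subset ⟨hRW, hRQ⟩ (Set.singleton_subset_iff.2 hmem)))
      (Set.toFinite _)
    omega
  obtain ⟨w, hwW, hwD, hb1, hwO⟩ : ∃ w ∈ W, quadForm w = 0 ∧ quadPolar v w = 1 ∧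
      hermForm σ w ≠ 0 := by
    refine ⟨(quadPolar v w₀)⁻¹ • w₀, W.smul_mem _ hw₀W, ?_, ?_, ?_⟩
    · rw [quadForm_smul, hw₀D, mul_zero]
    · rw [quadPolar_smul_right, inv_mul_cancel₀ hb]
    · rw [hermForm_smul]
      refine mul_ne_zero (mul_ne_zero (inv_ne_zero hb) ((map_ne_zero σ).2 (inv_ne_zero hb))) ?_
      intro hH
      obtain ⟨x, c, hx, hxc⟩ := exists_isVeronese_smul_eq hσσ hw₀D hH
      refine hRP ((hmemO _ hRW).1 ((mem_Oset_iff hσ).2 ⟨x, hx.ne_zero, hx, ?_⟩))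
      exact (Projectivization.mk_eq_mk_iff' F _ _ hw₀ hx.ne_zero).2 ⟨c, hxc.symm⟩
  have hpol : ∀ l : F, quadPolar v (w + l • v) = 1 := by
    intro l
    rw [quadPolar_add_right, quadPolar_smul_right, hV.quadPolar_self, hb1]; ring
  have hne : ∀ l : F, w + l • v ≠ 0 := by
    intro l h
    have := hpol l
    rw [h] at this
    simp [quadPolar] at this
  have hspan : W = Submodule.span F {v, w} := by
    refine eq_span_pair hW hv hvW hwW fun a ha => ?_
    rw [← ha, quadPolar_smul_right, hV.quadPolar_self, mul_zero] at hb1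
    exact zero_ne_one hb1
  have hinj : Function.Injective fun l : F => Projectivization.mk F (w + l • v) (hne l) := by
    intro l m h
    obtain ⟨a, ha⟩ := (Projectivization.mk_eq_mk_iff' F _ _ (hne l) (hne m)).1 h
    have ha1 := congrArg (quadPolar v) ha
    rw [quadPolar_smul_right, hpol, hpol, mul_one] at ha1
    rw [ha1, one_smul] at ha
    exact (smul_left_injective F hv (add_left_cancel ha)).symm
  have hmemC : ∀ l : F, Projectivization.mk F (w + l • v) (hne l) ∈
      Cgam (2 * k + 1) (u + u⁻¹) ↔ l + σ l - (u + u⁻¹) * l ^ (k + 1) = -hermForm σ w := by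
    intro l
    rw [mk_mem_Cgam hσ, hV.hermForm_add_smul hσσ, hV.quadForm_add_smul, hwD, hb1, map_one]
    constructor <;> intro h
    · linear_combination h
    · linear_combination h
  have hset : {P : PGPoint F | P.rep ∈ W} ∩ (Cgam (2 * k + 1) (u + u⁻¹) \ Oset F (2 * k + 1)) =
      (fun l : F => Projectivization.mk F (w + l • v) (hne l)) ''
        ↑(Finset.univ.filter fun l : F =>
          l + σ l - (u + u⁻¹) * l ^ (k + 1) = -hermForm σ w) := by
    ext P
    constructor
    · rintro ⟨hPW, hPC, hPO⟩
      rw [hmemO P hPW] at hPO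
      induction P using Projectivization.ind with | _ x hx => ?_
      have hxW := (mk_rep_mem_iff hx).1 hPW
      rw [hspan, Submodule.mem_span_pair] at hxW
      obtain ⟨b, a, rfl⟩ := hxW
      have ha : a ≠ 0 := by
        rintro rfl
        exact hPO ((Projectivization.mk_eq_mk_iff' F _ _ hx hv).2 ⟨b, by simp⟩)
      have e : Projectivization.mk F (w + (b / a) • v) (hne (b / a)) =
          Projectivization.mk F _ hx := by
        refine ((Projectivization.mk_eq_mk_iff' F _ _ hx (hne _)).2 ⟨a, ?_⟩).symm
        rw [smul_add, smul_smul, mul_div_cancel₀ _ ha, add_comm]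
      refine ⟨b / a, ?_, e⟩
      simp only [Finset.coe_filter, Finset.mem_univ, true_and, Set.mem_ofPred_eq]
      rw [← hmemC, e]
      exact hPC
    · rintro ⟨l, hl, rfl⟩
      simp only [Finset.coe_filter, Finset.mem_univ, true_and, Set.mem_ofPred_eq] at hl
      have hmW := (mk_rep_mem_iff (hne l)).2 (W.add_mem hwW (W.smul_mem l hvW))
      refine ⟨hmW, (hmemC l).2 hl, ?_⟩
      rw [hmemO _ hmW]
      intro h
      obtain ⟨a, ha⟩ := (Projectivization.mk_eq_mk_iff' F _ _ (hne l) hv).1 h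
      have h1 := hpol l
      rw [← ha, quadPolar_smul_right, hV.quadPolar_self, mul_zero] at h1
      exact zero_ne_one h1
  rw [hset, Set.ncard_image_of_injective _ hinj, Set.ncard_coe_finset]
  exact card_filter_add_sub_eq hσσ hσ hF hk hξ hκ hu huκ
    (by rw [map_neg, map_hermForm hσσ]) (neg_ne_zero.2 hwO)

lemma ncard_tangent (hσσ : ∀ x, σ (σ x) = x) (hσ : ∀ x, σ x = x ^ (2 * k + 1))
    (hF : Fintype.card F = (2 * k + 1) ^ 2) {u : F} (hu : u ^ 4 ≠ 1)
    (hu' : u ^ (4 * (k + 1)) = 1) (hV : IsVeronese σ v)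
    (hO : {P : PGPoint F | P.rep ∈ W} ∩ Oset F (2 * k + 1) = {Projectivization.mk F v hv})
    (hQ : ({P : PGPoint F | P.rep ∈ W} ∩ Qplus F).ncard = 1) :
    ({P : PGPoint F | P.rep ∈ W} ∩ (Cgam (2 * k + 1) (u + u⁻¹) \ Oset F (2 * k + 1))).ncard
      = 0 := by
  have hPO : Projectivization.mk F v hv ∈ {P : PGPoint F | P.rep ∈ W} ∩ Oset F (2 * k + 1) := by
    rw [hO]; rfl
  have hvW : v ∈ W := (mk_rep_mem_iff hv).1 hPO.1
  have hQ' : ∀ x : Fin 4 → F, x ∈ W → quadForm x = 0 → ∃ a : F, a • v = x := by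
    intro x hxW hxD
    by_cases hx : x = 0
    · exact ⟨0, by simp [hx]⟩
    obtain ⟨R, hR⟩ := Set.ncard_eq_one.1 hQ
    have h1 : Projectivization.mk F x hx ∈ {P : PGPoint F | P.rep ∈ W} ∩ Qplus F :=
      ⟨(mk_rep_mem_iff hx).2 hxW, (mk_mem_Qplus hx).2 hxD⟩
    have h2 : Projectivization.mk F v hv ∈ {P : PGPoint F | P.rep ∈ W} ∩ Qplus F :=
      ⟨hPO.1, (mk_mem_Qplus hv).2 hV.quadForm_eq_zero⟩
    rw [hR] at h1 h2
    exact (Projectivization.mk_eq_mk_iff' F _ _ hx hv).1 (h1.trans h2.symm)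
  rw [Set.ncard_eq_zero, Set.eq_empty_iff_forall_notMem]
  rintro R ⟨hRW, hRC, hRO⟩
  induction R using Projectivization.ind with | _ w hw => ?_
  have hwW : w ∈ W := (mk_rep_mem_iff hw).1 hRW
  have hindep : ∀ a : F, a • v ≠ w := by
    intro a ha
    apply hRO
    rw [(Projectivization.mk_eq_mk_iff' F _ _ hw hv).2 ⟨a, ha⟩]
    exact hPO.2
  have hD : ∀ l : F, quadForm (w + l • v) ≠ 0 := by
    intro l h
    obtain ⟨a, ha⟩ := hQ' _ (W.add_mem hwW (W.smul_mem l hvW)) h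
    apply hindep (a - l)
    rw [sub_smul, ha, add_sub_cancel_right]
  have hb : quadPolar v w = 0 := by
    by_contra hb
    apply hD (-quadForm w / quadPolar v w)
    rw [hV.quadForm_add_smul]
    field_simp
    ring
  exact hV.hermForm_ne_of_quadPolar_eq_zero hσσ hσ hF hu hu' hb (by simpa using hD 0)
    ((mk_mem_Cgam hσ hw).1 hRC)

end Lines


/-- Lemma 2.10: a line secant to `Q⁺(3,q²)` meeting `O` in exactly one point has
    `(q−1)/2` points of `S_j \ O`; a line tangent to `Q⁺(3,q²)` meeting `O` in
    exactly one point has none. -/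
theorem stmt10 {F : Type*} [Field F] [Fintype F] (p n q : ℕ) (hp : p.Prime)
    (hodd : Odd p) (hn : 0 < n) (hq : q = p ^ n) (hF : Fintype.card F = q ^ 2)
    (ξ : F) (hξ : ∀ x : F, x ≠ 0 → ∃ m : ℕ, x = ξ ^ m)
    (j : ℕ) (hj1 : 1 ≤ j) (hjq : j ≤ q) (hjne : j ≠ (q + 1) / 2) :
    (∀ ℓ : Set (PGPoint F), IsLine ℓ → (ℓ ∩ Qplus F).ncard = 2 →
      (ℓ ∩ Oset F q).ncard = 1 →
      (ℓ ∩ (Cgam q (ξ ^ (j * (q - 1) / 2) + (ξ ^ (j * (q - 1) / 2))⁻¹)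
        \ Oset F q)).ncard = (q - 1) / 2) ∧
    (∀ ℓ : Set (PGPoint F), IsLine ℓ → (ℓ ∩ Qplus F).ncard = 1 →
      (ℓ ∩ Oset F q).ncard = 1 →
      (ℓ ∩ (Cgam q (ξ ^ (j * (q - 1) / 2) + (ξ ^ (j * (q - 1) / 2))⁻¹)
        \ Oset F q)).ncard = 0) := by
  rw [hq] at hF
  obtain ⟨σ, hσ, hσσ⟩ := exists_ringHom_pow hp hF
  rw [← hq] at hσ hF
  have hq1 : 1 < q := hq ▸ Nat.one_lt_pow hn.ne' hp.one_lt
  obtain ⟨k, rfl⟩ : Odd q := hq ▸ hodd.pow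
  have hk : 0 < k := by omega
  have e1 : (2 * k + 1 - 1) / 2 = k := by omega
  have e2 : j * (2 * k + 1 - 1) / 2 = j * k := by
    rw [show j * (2 * k + 1 - 1) = 2 * (j * k) by rw [Nat.add_sub_cancel]; ring]
    omega
  have hcard : Fintype.card F - 1 = 4 * k * (k + 1) := by
    rw [hF]
    apply Nat.sub_eq_of_eq_add
    ring
  have hξ0 : ξ ≠ 0 := by
    rintro rfl
    have h1 : Fintype.card F ≤ 2 := by
      classical
      rw [← Finset.card_univ]
      refine (Finset.card_le_card (t := {0, 1}) fun x _ => ?_).trans Finset.card_le_two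
      by_cases hx : x = 0
      · simp [hx]
      · obtain ⟨m, rfl⟩ := hξ x hx
        rcases Nat.eq_zero_or_pos m with rfl | hm
        · simp
        · simp [hm.ne']
    rw [hF] at h1
    nlinarith
  have hprim := isPrimitiveRoot_of_forall_exists_pow hξ0 hξ
  have hu : (ξ ^ (j * k)) ^ 4 ≠ 1 := by
    rw [← pow_mul, Ne, hprim.pow_eq_one_iff_dvd, hcard]
    intro h
    have h' : (4 * k) * (k + 1) ∣ (4 * k) * j := by
      rwa [show 4 * k * j = j * k * 4 by ring]
    obtain ⟨c, rfl⟩ := Nat.dvd_of_mul_dvd_mul_left (by omega) h'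
    have hc : c < 2 := by
      by_contra! hc
      nlinarith
    interval_cases c <;> omega
  have hu' : (ξ ^ (j * k)) ^ (4 * (k + 1)) = 1 := by
    rw [← pow_mul, hprim.pow_eq_one_iff_dvd, hcard]
    exact ⟨j, by ring⟩
  have hmain : ∀ ℓ : Set (PGPoint F), (ℓ ∩ Oset F (2 * k + 1)).ncard = 1 →
      ∃ (v : Fin 4 → F) (hv : v ≠ 0), IsVeronese σ v ∧
        ℓ ∩ Oset F (2 * k + 1) = {Projectivization.mk F v hv} := by
    intro ℓ h
    obtain ⟨P, hP⟩ := Set.ncard_eq_one.1 h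
    have hPO : P ∈ ℓ ∩ Oset F (2 * k + 1) := by rw [hP]; rfl
    obtain ⟨v, hv, hV, rfl⟩ := (mem_Oset_iff hσ).1 hPO.2
    exact ⟨v, hv, hV, hP⟩
  rw [e1, e2]
  constructor
  · rintro ℓ ⟨W, hW, rfl⟩ hQ hO
    obtain ⟨v, hv, hV, hP⟩ := hmain _ hO
    exact ncard_secant hσσ hσ hF hk hprim (pow_ne_zero j hξ0) hu (pow_mul ξ j k) hW hV hP hQ
  · rintro ℓ ⟨W, hW, rfl⟩ hQ hO
    obtain ⟨v, hv, hV, hP⟩ := hmain _ hO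
    exact ncard_tangent hσσ hσ hF hu hu' hV hP hQ
end
end

section
/- Let q be an odd prime power. For every k ∈ {1,…,q−2} with k ≠ (q−1)/2, there are exactly (q+1)(q²+1) lines of PG(3,q²) entirely contained in E_k; through each point of E_k \ O there pass exactly two such lines, through each point of O there pass exactly q+1 such lines, and every line contained in E_k meets the Baer subgeometry Σ in exactly one point. -/
noncomputable section

open Matrix

/-- The `q`-power map is an additive involution of `F` in odd characteristic, `2N = q + 1`. -/
structure QInvolution (F : Type*) [Field F] (q N : ℕ) : Prop where
  two_mul : 2 * N = q + 1
  three_le : 3 ≤ q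
  add : ∀ x y : F, (x + y) ^ q = x ^ q + y ^ q
  sub : ∀ x y : F, (x - y) ^ q = x ^ q - y ^ q
  neg : ∀ x : F, (-x) ^ q = -x ^ q
  invol : ∀ x : F, (x ^ q) ^ q = x
  two_ne : (2 : F) ≠ 0
  cast_q : (q : F) = 0

/-- The parameter `γ = l + l⁻¹` with `l⁴ ≠ 1`, where `l` is a `q`-eigenvector and both `-l` and
`-l⁻¹` are `N`-th powers, with `F` containing all `N`-th roots of unity. -/
structure Admissible {F : Type*} [Field F] (q N : ℕ) (l γ : F) : Prop where
  eq : γ = l + l⁻¹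
  ne_zero : l ≠ 0
  sq_ne_one : l ^ 2 ≠ 1
  sq_ne_neg_one : l ^ 2 ≠ -1
  eigen : ∃ σ : F, σ ^ 2 = 1 ∧ l ^ q = σ * l
  root : ∃ a : F, a ^ N = -l
  root_inv : ∃ a : F, a ^ N = -l⁻¹
  primitive : ∃ ζ : F, IsPrimitiveRoot ζ N

/-- The quadratic form `X₁X₄ - X₂X₃`. -/
def quad {F : Type*} [Field F] (x : Fin 4 → F) : F := x 0 * x 3 - x 1 * x 2

/-- The polar form of `quad`. -/
def polar4 {F : Type*} [Field F] (x y : Fin 4 → F) : F :=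
  x 0 * y 3 + x 3 * y 0 - x 1 * y 2 - x 2 * y 1

/-- The Hermitian form `X₁^q X₄ + X₁ X₄^q - X₂^{q+1} - X₃^{q+1}`. -/
def herm {F : Type*} [Field F] (q : ℕ) (x : Fin 4 → F) : F :=
  x 0 ^ q * x 3 + x 0 * x 3 ^ q - x 1 ^ (q + 1) - x 2 ^ (q + 1)

/-- The standard vectors representing the points of `Oset`. -/
def veronese {F : Type*} [Field F] (q : ℕ) : Option F → Fin 4 → F
  | none => ![0, 0, 0, 1]
  | some t => ![1, t, t ^ q, t ^ (q + 1)]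

/-- A vector orthogonal to `veronese q o`. -/
def tangentVec {F : Type*} [Field F] (q : ℕ) : Option F → F → F → Fin 4 → F
  | none, b, c => ![0, b, c, 0]
  | some t, b, c => ![0, b, c, b * t ^ q + c * t]

/-- The line through `veronese q o` with direction `tangentVec q o m 1`. -/
def tangentLine {F : Type*} [Field F] (q : ℕ) (o : Option F) (m : F) :
    Submodule F (Fin 4 → F) :=
  Submodule.span F {veronese q o, tangentVec q o m 1}

/-- The slopes `m` for which `tangentLine q o m` lies in `Cgam q γ`. -/
def slopes {F : Type*} [Field F] (q N : ℕ) (γ : F) : Set F :=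
  {m | m ^ (q + 1) + 1 + γ * (-m) ^ N = 0}

section Helpers

variable {F : Type*} [Field F] {q N : ℕ} {l γ : F}

theorem Fgam_eq_s11 (h : QInvolution F q N) (x : Fin 4 → F) :
    Fgam q γ x = herm q x - γ * quad x ^ N := by
  have : (q + 1) / 2 = N := by have := h.two_mul; omega
  simp [Fgam, herm, quad, this]

theorem Fgam_smul (h : QInvolution F q N) (a : F) (x : Fin 4 → F) :
    Fgam q γ (a • x) = a ^ (q + 1) * Fgam q γ x := by
  have e : quad (a • x) ^ N = a ^ (q + 1) * quad x ^ N := by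
    rw [← h.two_mul, pow_mul, ← mul_pow]
    congr 1
    simp [quad]; ring
  rw [Fgam_eq_s11 h, Fgam_eq_s11 h, e]
  simp [herm, mul_pow]; ring

/-- If `γ g^N` agrees on `F` with a polynomial in the monomials `1, s, s^q, s^(q+1)`, then the
quadratic polynomial `g` has zero discriminant. -/
theorem discrim_eq_zero_of_pow_eq [Fintype F] (h : QInvolution F q N)
    (hF : Fintype.card F = q ^ 2) (hγ : γ ≠ 0)
    (a b c h₀ h₁ h₂ h₃ : F)
    (H : ∀ s : F, h₀ + h₁ * s ^ q + h₂ * s + h₃ * s ^ (q + 1) = γ * (a + b * s + c * s ^ 2) ^ N) :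
    b ^ 2 = 4 * a * c := by
  open Polynomial in
  have hN := h.two_mul
  have h3 := h.three_le
  set g : F[X] := C a + C b * X + C c * X ^ 2 with hg
  set r : F[X] := C h₀ + C h₁ * X ^ q + C h₂ * X + C h₃ * X ^ (q + 1) with hr
  have key : C γ * g ^ N - r = 0 := by
    apply eq_zero_of_natDegree_lt_card_of_eval_eq_zero' _ Finset.univ
    · intro s _
      simp [hg, hr, ← H s]
    · rw [Finset.card_univ, hF]
      have d1 : (C γ * g ^ N).natDegree ≤ q + 1 := by
        have hg2 : g.natDegree ≤ 2 := by rw [hg]; compute_degree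
        calc (C γ * g ^ N).natDegree ≤ (g ^ N).natDegree := natDegree_C_mul_le _ _
          _ ≤ N * 2 := natDegree_pow_le_of_le _ hg2
          _ = q + 1 := by omega
      have d2 : r.natDegree ≤ q + 1 := by
        rw [hr]; compute_degree
      have := natDegree_sub_le_of_le d1 d2
      rw [max_self] at this
      nlinarith
  rw [sub_eq_zero] at key
  have e0 : C (γ ^ 2) * g ^ q * g = r ^ 2 := by
    rw [← key, mul_pow, ← pow_mul, mul_comm N 2, hN, C_pow]; ring
  have dg : derivative g = C b + 2 * C c * X := by
    simp [hg]; ring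
  have ddg : derivative (derivative g) = 2 * C c := by
    rw [dg]; simp
  have dX : derivative (X ^ q : F[X]) = 0 := by
    rw [derivative_X_pow]; simp [h.cast_q]
  have dr : derivative r = C h₂ + C h₃ * X ^ q := by
    simp [hr, dX, pow_succ]
  have ddr : derivative (derivative r) = 0 := by
    rw [dr]; simp [dX]
  have dgq : derivative (g ^ q) = 0 := by
    rw [derivative_pow]; simp [h.cast_q]
  have e1 : C (γ ^ 2) * g ^ q * derivative g = 2 * r * derivative r := by
    have := congrArg derivative e0
    rw [sq r] at this
    simp only [derivative_mul, derivative_C, dgq] at this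
    linear_combination this
  have e2 : C (γ ^ 2) * g ^ q * derivative (derivative g) = 2 * derivative r ^ 2 := by
    have := congrArg derivative e1
    simp only [derivative_mul, derivative_C, dgq, ddr] at this
    have h2 : derivative (2 : F[X]) = 0 := derivative_ofNat 2
    rw [h2] at this
    linear_combination this
  by_cases hg0 : g = 0
  · have ha : a = 0 := by simpa [hg] using congrArg (eval 0) hg0
    have hb : b = 0 := by
      have := congrArg (fun p => eval 0 (derivative p)) hg0
      simpa [dg] using this
    simp [ha, hb]
  · have hne : C (γ ^ 2) * g ^ q ≠ 0 :=
      mul_ne_zero (by simpa using hγ) (pow_ne_zero _ hg0)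
    have : derivative g ^ 2 = 2 * g * derivative (derivative g) := by
      apply mul_left_cancel₀ (pow_ne_zero 2 hne)
      linear_combination (C (γ ^ 2) * g ^ q * derivative g + 2 * r * derivative r) * e1
        - 2 * (C (γ ^ 2) * g ^ q * derivative (derivative g)) * e0 - 2 * r ^ 2 * e2
    rw [dg] at this
    have := congrArg (eval 0) this
    simp [hg] at this
    linear_combination this

theorem polar_sq_eq [Fintype F] (h : QInvolution F q N)
    (hF : Fintype.card F = q ^ 2) (hγ : γ ≠ 0) (x y : Fin 4 → F)
    (H : ∀ s : F, Fgam q γ (x + s • y) = 0) :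
    polar4 x y ^ 2 = 4 * quad x * quad y := by
  apply discrim_eq_zero_of_pow_eq h hF hγ (quad x) (polar4 x y) (quad y) (herm q x)
    (y 0 ^ q * x 3 + x 0 * y 3 ^ q - y 1 ^ q * x 1 - y 2 ^ q * x 2)
    (x 0 ^ q * y 3 + y 0 * x 3 ^ q - x 1 ^ q * y 1 - x 2 ^ q * y 2) (herm q y)
  intro s
  have hs := H s
  rw [Fgam_eq_s11 h] at hs
  have e : quad (x + s • y) = quad x + polar4 x y * s + quad y * s ^ 2 := by
    simp [quad, polar4]; ring
  rw [← e]
  simp only [herm, Pi.add_apply, Pi.smul_apply, smul_eq_mul, pow_succ, h.add, mul_pow] at hs ⊢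
  linear_combination hs

theorem exists_veronese (h : QInvolution F q N) (x : Fin 4 → F) (hx : x ≠ 0)
    (hQ : quad x = 0) (hF : Fgam q γ x = 0) :
    ∃ (o : Option F) (a : F), a ≠ 0 ∧ x = a • veronese q o := by
  have hN0 : N ≠ 0 := by have := h.two_mul; omega
  have hq0 : q ≠ 0 := by have := h.three_le; omega
  have hH : herm q x = 0 := by
    rw [Fgam_eq_s11 h, hQ, zero_pow hN0] at hF
    linear_combination hF
  simp only [quad, herm] at hQ hH
  by_cases h0 : x 0 = 0
  · have h12 : x 1 = 0 ∧ x 2 = 0 := by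
      rw [h0] at hQ hH
      have : x 1 = 0 ∨ x 2 = 0 := by
        rw [← mul_eq_zero]; linear_combination -hQ
      rcases this with h1 | h1 <;> simpa [h1, hq0] using hH
    refine ⟨none, x 3, ?_, ?_⟩
    · intro h3
      apply hx
      ext i; fin_cases i <;> simp [h0, h12, h3]
    · ext i; fin_cases i <;> simp [veronese, h0, h12]
  · refine ⟨some (x 1 / x 0), x 0, h0, ?_⟩
    have h3 : x 3 = x 1 * x 2 / x 0 := by field_simp; linear_combination hQ
    have hz : x 0 ^ q ≠ 0 := pow_ne_zero _ h0
    have h2 : x 2 = x 0 * (x 1 / x 0) ^ q := by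
      have : (x 2 / x 0 - (x 1 / x 0) ^ q) ^ (q + 1) = 0 := by
        rw [pow_succ, h.sub, h.invol, div_pow, div_pow]
        rw [h3] at hH
        simp only [div_pow, mul_pow, pow_succ] at hH
        field_simp at hH ⊢
        linear_combination -hH
      have := pow_eq_zero_iff (by omega) |>.1 this
      field_simp at this ⊢
      linear_combination this
    have h3' : x 3 = x 0 * (x 1 / x 0) ^ (q + 1) := by
      rw [h3, h2, pow_succ]
      generalize (x 1 / x 0) ^ q = w
      field_simp
    ext i; fin_cases i
    · simp [veronese]
    · simp [veronese]; field_simp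
    · simpa [veronese] using h2
    · simpa [veronese] using h3'

theorem polar_veronese_add (o : Option F) (x y : Fin 4 → F) (a b : F) :
    polar4 (veronese q o) (a • x + b • y)
      = a * polar4 (veronese q o) x + b * polar4 (veronese q o) y := by
  simp [polar4]; ring

theorem polar_veronese_tangentVec (o : Option F) (b c : F) :
    polar4 (veronese q o) (tangentVec q o b c) = 0 := by
  cases o <;> simp [polar4, veronese, tangentVec]; ring

theorem quad_veronese (o : Option F) : quad (veronese q o) = 0 := by
  cases o <;> simp [quad, veronese]; ring

theorem polar_veronese_self (o : Option F) : polar4 (veronese q o) (veronese q o) = 0 := by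
  cases o <;> simp [polar4, veronese]; ring

theorem veronese_ne_zero (o : Option F) : veronese q o ≠ 0 := by
  intro e
  cases o
  · simpa [veronese] using congrFun e 3
  · simpa [veronese] using congrFun e 0

theorem eq_of_polar_veronese_eq_zero (h : QInvolution F q N) (o o' : Option F)
    (H : polar4 (veronese q o) (veronese q o') = 0) : o = o' := by
  rcases o with _ | t <;> rcases o' with _ | s
  · rfl
  · simp [polar4, veronese] at H
  · simp [polar4, veronese] at H
  · have : (s - t) ^ (q + 1) = 0 := by
      rw [pow_succ, h.sub]
      simp [polar4, veronese, pow_succ] at H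
      linear_combination H
    have := pow_eq_zero_iff (by omega) |>.1 this
    rw [sub_eq_zero.1 this]

theorem exists_tangentVec (o : Option F) (x : Fin 4 → F)
    (H : polar4 (veronese q o) x = 0) :
    ∃ a b c : F, x = a • veronese q o + tangentVec q o b c := by
  rcases o with _ | t
  · refine ⟨x 3, x 1, x 2, ?_⟩
    simp [polar4, veronese] at H
    ext i; fin_cases i <;> simp [veronese, tangentVec, H]
  · refine ⟨x 0, x 1 - x 0 * t, x 2 - x 0 * t ^ q, ?_⟩
    simp [polar4, veronese] at H
    ext i; fin_cases i <;> simp [veronese, tangentVec]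
    linear_combination H

theorem Fgam_veronese_add (h : QInvolution F q N) (o : Option F) (a b c : F) :
    Fgam q γ (a • veronese q o + tangentVec q o b c)
      = -(b ^ (q + 1) + c ^ (q + 1) + γ * (-(b * c)) ^ N) := by
  have hq0 : q ≠ 0 := by have := h.three_le; omega
  have e : quad (a • veronese q o + tangentVec q o b c) = -(b * c) := by
    cases o <;> simp [quad, veronese, tangentVec]; ring
  rw [Fgam_eq_s11 h, e]
  cases o
  · simp [herm, veronese, tangentVec, hq0]; ring
  · simp [herm, veronese, tangentVec, pow_succ, h.add, mul_pow, h.invol]; ring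

theorem tangentVec_smul (o : Option F) (a b c : F) :
    tangentVec q o (a * b) (a * c) = a • tangentVec q o b c := by
  cases o <;> ext i <;> fin_cases i <;> simp [tangentVec]; ring

theorem veronese_tangentVec_eq_iff (o : Option F) (a b c a' b' c' : F) :
    a • veronese q o + tangentVec q o b c = a' • veronese q o + tangentVec q o b' c'
      ↔ a = a' ∧ b = b' ∧ c = c' := by
  constructor
  · intro e
    have e0 := congrFun e 0
    have e1 := congrFun e 1
    have e2 := congrFun e 2
    have e3 := congrFun e 3
    cases o <;> simp [veronese, tangentVec] at e0 e1 e2 e3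
    · exact ⟨e3, e1, e2⟩
    · subst e0; simp at e1 e2; exact ⟨rfl, e1, e2⟩
  · rintro ⟨rfl, rfl, rfl⟩; rfl

theorem mem_tangentLine_iff (o : Option F) (m : F) (v : Fin 4 → F) :
    v ∈ tangentLine q o m ↔ ∃ a c : F, v = a • veronese q o + tangentVec q o (c * m) c := by
  have e : ∀ c : F, tangentVec q o (c * m) c = c • tangentVec q o m 1 := fun c => by
    simpa using tangentVec_smul o c m 1
  simp only [tangentLine, Submodule.mem_span_pair, e, eq_comm]

theorem veronese_mem_tangentLine (o : Option F) (m : F) :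
    veronese q o ∈ tangentLine q o m :=
  Submodule.subset_span (by simp)

theorem finrank_tangentLine (o : Option F) (m : F) :
    Module.finrank F (tangentLine q o m) = 2 := by
  have hli : LinearIndependent F ![veronese q o, tangentVec q o m 1] := by
    rw [LinearIndependent.pair_iff]
    intro s t hst
    rw [← tangentVec_smul] at hst
    have h0 : (0 : Fin 4 → F) = (0 : F) • veronese q o + tangentVec q o 0 0 := by
      cases o <;> ext i <;> fin_cases i <;> simp [tangentVec]
    rw [h0, veronese_tangentVec_eq_iff] at hst
    exact ⟨hst.1, by simpa using hst.2.2⟩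
  have := finrank_span_eq_card hli
  rwa [Matrix.range_cons, Matrix.range_cons, Matrix.range_empty, Set.union_empty,
    Set.singleton_union, Fintype.card_fin] at this

theorem polar_eq_zero_of_mem_tangentLine {o : Option F} {m : F} {v : Fin 4 → F}
    (hv : v ∈ tangentLine q o m) : polar4 (veronese q o) v = 0 := by
  obtain ⟨a, c, rfl⟩ := (mem_tangentLine_iff o m v).1 hv
  have := polar_veronese_add (q := q) o (veronese q o) (tangentVec q o (c * m) c) a 1
  rw [one_smul] at this
  rw [this, polar_veronese_self, polar_veronese_tangentVec]
  ring

theorem Fgam_eq_zero_of_mem_tangentLine (h : QInvolution F q N) {o : Option F} {m : F}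
    (hm : m ∈ slopes q N γ) {v : Fin 4 → F} (hv : v ∈ tangentLine q o m) :
    Fgam q γ v = 0 := by
  obtain ⟨a, c, rfl⟩ := (mem_tangentLine_iff o m v).1 hv
  have e : (-(c * m * c)) ^ N = c ^ (q + 1) * (-m) ^ N := by
    rw [← h.two_mul, pow_mul, ← mul_pow]; congr 1; ring
  rw [Fgam_veronese_add h, e, mul_pow]
  have hm' : m ^ (q + 1) + 1 + γ * (-m) ^ N = 0 := hm
  linear_combination -c ^ (q + 1) * hm'

theorem eq_of_veronese_mem_tangentLine (h : QInvolution F q N) {o o' : Option F} {m : F}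
    (hv : veronese q o' ∈ tangentLine q o m) : o = o' :=
  eq_of_polar_veronese_eq_zero h o o' (polar_eq_zero_of_mem_tangentLine hv)

theorem tangentLine_injective (h : QInvolution F q N) {o o' : Option F} {m m' : F}
    (e : tangentLine q o m = tangentLine q o' m') : o = o' ∧ m = m' := by
  have ho : o = o' := eq_of_veronese_mem_tangentLine h (m := m)
    (e ▸ veronese_mem_tangentLine o' m')
  subst ho
  refine ⟨rfl, ?_⟩
  have : tangentVec q o m' 1 ∈ tangentLine q o m := e ▸ Submodule.subset_span (by simp)
  obtain ⟨a, c, hac⟩ := (mem_tangentLine_iff o m _).1 this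
  have h0 : tangentVec q o m' 1 = (0 : F) • veronese q o + tangentVec q o m' 1 := by simp
  rw [h0, veronese_tangentVec_eq_iff] at hac
  rw [hac.2.1, ← hac.2.2, one_mul]

/-- A point of the tangent plane at `veronese q o` which lies on `Cgam q γ` and differs from the
tangency point determines an admissible slope. -/
theorem exists_slope (h : QInvolution F q N) {o : Option F} {x : Fin 4 → F}
    (hp : polar4 (veronese q o) x = 0) (hx : Fgam q γ x = 0)
    (hne : ∀ a : F, x ≠ a • veronese q o) :
    ∃ m ∈ slopes q N γ, x ∈ tangentLine q o m ∧ tangentVec q o m 1 ∈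
      Submodule.span F {veronese q o, x} := by
  have hN0 : N ≠ 0 := by have := h.two_mul; omega
  obtain ⟨a, b, c, rfl⟩ := exists_tangentVec o x hp
  rw [Fgam_veronese_add h, neg_eq_zero] at hx
  have hc : c ≠ 0 := by
    rintro rfl
    have hb : b = 0 := by simpa [hN0] using hx
    apply hne a
    rw [hb]
    cases o <;> ext i <;> fin_cases i <;> simp [tangentVec]
  refine ⟨b / c, ?_, ?_, ?_⟩
  · have e : (-(b * c)) ^ N = c ^ (q + 1) * (-(b / c)) ^ N := by
      rw [← h.two_mul, pow_mul, ← mul_pow]; congr 1; field_simp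
    have e' : b ^ (q + 1) = c ^ (q + 1) * (b / c) ^ (q + 1) := by
      rw [← mul_pow]; congr 1; field_simp
    rw [e, e'] at hx
    apply mul_left_cancel₀ (pow_ne_zero (q + 1) hc)
    linear_combination hx
  · rw [mem_tangentLine_iff]
    exact ⟨a, c, by rw [mul_div_cancel₀ _ hc]⟩
  · rw [Submodule.mem_span_pair]
    refine ⟨-(c⁻¹ * a), c⁻¹, ?_⟩
    have : tangentVec q o (b / c) 1 = c⁻¹ • tangentVec q o b c := by
      rw [← tangentVec_smul]; congr 1 <;> field_simp
    rw [this]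
    module

theorem exists_tangentLine_eq [Fintype F] (h : QInvolution F q N)
    (hF : Fintype.card F = q ^ 2) (hγ : γ ≠ 0) (W : Submodule F (Fin 4 → F))
    (hW : Module.finrank F W = 2) (H : ∀ v ∈ W, Fgam q γ v = 0) :
    ∃ (o : Option F) (m : F), m ∈ slopes q N γ ∧ W = tangentLine q o m := by
  have h2 : (2 : F) ≠ 0 := h.two_ne
  have hnt : Nontrivial W := Module.nontrivial_of_finrank_pos (R := F) (by omega)
  have hpair : ∀ x ∈ W, x ≠ 0 → ∃ y ∈ W, ∀ a : F, y ≠ a • x := by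
    intro x hx hx0
    obtain ⟨y, hy⟩ := exists_linearIndependent_pair_of_one_lt_finrank
      (R := F) (M := W) (by omega) (x := ⟨x, hx⟩) (by simpa using hx0)
    refine ⟨y, y.2, fun a ha => ?_⟩
    rw [LinearIndependent.pair_iff' (by simpa using hx0)] at hy
    exact hy a (Subtype.ext ha.symm)
  have hline : ∀ x ∈ W, ∀ y ∈ W, polar4 x y ^ 2 = 4 * quad x * quad y := fun x hx y hy =>
    polar_sq_eq h hF hγ x y fun s => H _ (W.add_mem hx (W.smul_mem s hy))
  have hsing : ∃ v ∈ W, v ≠ 0 ∧ quad v = 0 := by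
    obtain ⟨⟨x, hx⟩, hx0⟩ := exists_ne (0 : W)
    replace hx0 : x ≠ 0 := by simpa using hx0
    obtain ⟨y, hy, hxy⟩ := hpair x hx hx0
    by_cases hQ : quad x = 0
    · exact ⟨x, hx, hx0, hQ⟩
    · refine ⟨y + (-(polar4 x y / (2 * quad x))) • x, W.add_mem hy (W.smul_mem _ hx), ?_, ?_⟩
      · intro e
        apply hxy (polar4 x y / (2 * quad x))
        rwa [neg_smul, ← sub_eq_add_neg, sub_eq_zero] at e
      · have e : quad (y + (-(polar4 x y / (2 * quad x))) • x)
            = quad y - polar4 x y / (2 * quad x) * polar4 x y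
              + (polar4 x y / (2 * quad x)) ^ 2 * quad x := by
          simp [quad, polar4]; ring
        rw [e]
        have := hline x hx y hy
        field_simp
        linear_combination -this
  obtain ⟨v, hv, hv0, hQv⟩ := hsing
  obtain ⟨o, a, ha, rfl⟩ := exists_veronese h v hv0 hQv (H v hv)
  have ho : veronese q o ∈ W := by
    have := W.smul_mem a⁻¹ hv
    rwa [smul_smul, inv_mul_cancel₀ ha, one_smul] at this
  obtain ⟨y, hy, hoy⟩ := hpair _ ho (veronese_ne_zero o)
  have hp : polar4 (veronese q o) y = 0 := by
    have := hline _ ho y hy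
    rw [quad_veronese] at this
    simpa using this
  obtain ⟨m, hm, -, hm'⟩ := exists_slope h hp (H y hy) hoy
  refine ⟨o, m, hm, (Submodule.eq_of_le_of_finrank_eq ?_ ?_).symm⟩
  · rw [tangentLine, Submodule.span_le]
    rintro z (rfl | rfl)
    · exact ho
    · refine Submodule.span_le.2 ?_ hm'
      rintro z (rfl | rfl)
      · exact ho
      · exact hy
  · rw [finrank_tangentLine, hW]

theorem Admissible.gamma_ne_zero (hl : Admissible q N l γ) : γ ≠ 0 := by
  have h0 := hl.ne_zero
  intro e
  apply hl.sq_ne_neg_one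
  have := hl.eq
  rw [e] at this
  field_simp at this
  linear_combination -this

/-- On `Cgam q γ` the discriminant `H² - 4 Q^{q+1}` is a square of the fixed field of `x ↦ x^q`. -/
theorem exists_sqrt (h : QInvolution F q N) (hl : Admissible q N l γ) {x : Fin 4 → F}
    (hx : Fgam q γ x = 0) (hQ : quad x ≠ 0) :
    ∃ η : F, η ≠ 0 ∧ η ^ q = η ∧ η ^ 2 = herm q x ^ 2 - 4 * (quad x ^ q * quad x) := by
  have h0 := hl.ne_zero
  have hγ := hl.gamma_ne_zero
  obtain ⟨σ, hσ, hlσ⟩ := hl.eigen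
  have hσ0 : σ ≠ 0 := by rintro rfl; simp at hσ
  have hiσ : (l⁻¹) ^ q = σ * l⁻¹ := by
    rw [inv_pow, hlσ, mul_inv]
    congr 1
    field_simp
    linear_combination -hσ
  have hγσ : γ ^ q = σ * γ := by rw [hl.eq, h.add, hlσ, hiσ]; ring
  rw [Fgam_eq_s11 h, sub_eq_zero] at hx
  have hH : herm q x ^ q = herm q x := by
    simp only [herm, h.add, h.sub, pow_succ, mul_pow, h.invol]; ring
  have hP : (quad x ^ N) ^ q = σ * quad x ^ N := by
    rw [hx, mul_pow, hγσ] at hH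
    apply mul_left_cancel₀ (mul_ne_zero hσ0 hγ)
    linear_combination hH - γ * quad x ^ N * hσ
  have hP2 : (quad x ^ N) ^ 2 = quad x ^ q * quad x := by
    rw [← pow_mul, mul_comm, h.two_mul, pow_succ]
  have hll : l * l⁻¹ = 1 := mul_inv_cancel₀ h0
  refine ⟨(l - l⁻¹) * quad x ^ N, mul_ne_zero ?_ (pow_ne_zero _ hQ), ?_, ?_⟩
  · intro e
    apply hl.sq_ne_one
    linear_combination l * e + hll
  · rw [mul_pow, hP, h.sub, hlσ, hiσ]
    linear_combination (l - l⁻¹) * quad x ^ N * hσ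
  · rw [hx, hl.eq, ← hP2]
    linear_combination (-4 * (quad x ^ N) ^ 2) * hll

theorem exists_two_affine (h : QInvolution F q N) (a b c η : F) (h0 : η ≠ 0) (hη : η ^ q = η)
    (hη2 : η ^ 2 = (c + c ^ q - a ^ q * a - b ^ q * b) ^ 2 - 4 * ((c - a * b) ^ q * (c - a * b))) :
    ∃ t₁ t₂ : F, t₁ ≠ t₂ ∧ ∀ t : F, c + t ^ q * t - t * b - t ^ q * a = 0 ↔ t = t₁ ∨ t = t₂ := by
  have h2 := h.two_ne
  rw [h.sub, mul_pow] at hη2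
  have hd : b - a ^ q ≠ 0 := by
    intro hd
    rw [sub_eq_zero] at hd
    have hb : b ^ q = a := by rw [hd, h.invol]
    have : (η - (c - c ^ q)) * (η + (c - c ^ q)) = 0 := by
      rw [hb] at hη2
      rw [← hd] at hη2
      linear_combination hη2
    have hs : η = -η := by
      rcases mul_eq_zero.1 this with e | e
      · have e' : η = c - c ^ q := by linear_combination e
        conv_lhs => rw [← hη, e', h.sub, h.invol]
        rw [e']; ring
      · have e' : η = c ^ q - c := by linear_combination e
        conv_lhs => rw [← hη, e', h.sub, h.invol]
        rw [e']; ring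
    have : 2 * η = 0 := by linear_combination hs
    exact (mul_ne_zero h2 h0) this
  have hD : b ^ q - a ≠ 0 := by
    have := pow_ne_zero q hd
    rwa [h.sub, h.invol] at this
  have h2q : (2 : F) ^ q = 2 := by
    have := h.add 1 1
    rw [one_pow, one_add_one_eq_two] at this
    exact this
  have hback : ∀ e : F, e ^ q = e → e ^ 2 = η ^ 2 → ∀ t : F,
      t = (c - c ^ q + b ^ q * b - a ^ q * a + e) / (2 * (b - a ^ q)) →
      c + t ^ q * t - t * b - t ^ q * a = 0 := by
    intro e he he2 t ht
    have hT : t ^ q = (c ^ q - c + b * b ^ q - a * a ^ q + e) / (2 * (b ^ q - a)) := by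
      rw [ht, div_pow, mul_pow, h2q, h.sub b, h.add, h.sub (_ + _), h.add, h.sub c, mul_pow,
        mul_pow, h.invol, h.invol, h.invol, he]
    rw [hT, ht]
    rw [hη2] at he2
    field_simp
    linear_combination he2
  have hne : 2 * (b - a ^ q) ≠ 0 := mul_ne_zero h2 hd
  refine ⟨(c - c ^ q + b ^ q * b - a ^ q * a + η) / (2 * (b - a ^ q)),
    (c - c ^ q + b ^ q * b - a ^ q * a + -η) / (2 * (b - a ^ q)), ?_, fun t => ⟨?_, ?_⟩⟩
  · intro e
    rw [div_left_inj' hne] at e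
    exact (mul_ne_zero h2 h0) (by linear_combination e)
  · intro e
    have e' : c ^ q + t ^ q * t - t ^ q * b ^ q - t * a ^ q = 0 := by
      have := congrArg (· ^ q) e
      simp only [h.sub, h.add, mul_pow, h.invol] at this
      rw [zero_pow (by have := h.three_le; omega)] at this
      linear_combination this
    have hT : t ^ q * (b ^ q - a) = t * (b - a ^ q) - (c - c ^ q) := by
      linear_combination e - e'
    have : (t * (2 * (b - a ^ q)) - (c - c ^ q + b ^ q * b - a ^ q * a + η)) *
        (t * (2 * (b - a ^ q)) - (c - c ^ q + b ^ q * b - a ^ q * a + -η)) = 0 := by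
      linear_combination 4 * (b - a ^ q) * (b ^ q - a) * e - 4 * (b - a ^ q) * (t - a) * hT - hη2
    rcases mul_eq_zero.1 this with e1 | e1
    · left; rw [eq_div_iff hne]; linear_combination e1
    · right; rw [eq_div_iff hne]; linear_combination e1
  · rintro (e | e)
    · exact hback η hη rfl t e
    · exact hback (-η) (by rw [h.neg, hη]) (by ring) t e

theorem ncard_polar_eq_zero (h : QInvolution F q N) (hl : Admissible q N l γ) {x : Fin 4 → F}
    (hx : Fgam q γ x = 0) (hQ : quad x ≠ 0) :
    {o : Option F | polar4 (veronese q o) x = 0}.ncard = 2 := by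
  have hq0 : q ≠ 0 := by have := h.three_le; omega
  by_cases h0 : x 0 = 0
  · obtain ⟨η, hη, -, hη2⟩ := exists_sqrt h hl hx hQ
    have hd : x 2 ^ q * x 2 - x 1 ^ q * x 1 ≠ 0 := by
      intro e
      apply hη
      have : η ^ 2 = (x 2 ^ q * x 2 - x 1 ^ q * x 1) ^ 2 := by
        rw [hη2]
        simp only [herm, quad, h0, h.sub, mul_pow, zero_pow hq0]
        ring
      rw [e] at this
      simpa using this
    have : {o : Option F | polar4 (veronese q o) x = 0} = {none, some
        ((x 3 * x 2 ^ q - x 3 ^ q * x 1) / (x 2 ^ q * x 2 - x 1 ^ q * x 1))} := by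
      ext o
      rcases o with _ | t
      · simp [polar4, veronese, h0]
      · simp only [polar4, veronese, Set.mem_ofPred_eq, Set.mem_insert_iff, reduceCtorEq,
          Set.mem_singleton_iff, Option.some.injEq, false_or, Matrix.cons_val, h0]
        rw [eq_div_iff hd]
        constructor
        · intro e
          have e' := congrArg (· ^ q) e
          simp only [h.sub, h.add, mul_pow, h.invol, zero_pow hq0, one_pow] at e'
          linear_combination -x 2 ^ q * e + x 1 * e'
        · intro e
          have e' := congrArg (· ^ q) e
          simp only [h.sub, mul_pow, h.invol] at e'
          apply mul_left_cancel₀ hd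
          linear_combination -x 2 * e - x 1 * e'
    rw [this, Set.ncard_pair (by simp)]
  · have hy : Fgam q γ ((x 0)⁻¹ • x) = 0 := by rw [Fgam_smul h, hx, mul_zero]
    have hQy : quad ((x 0)⁻¹ • x) ≠ 0 := by
      have : quad ((x 0)⁻¹ • x) = (x 0)⁻¹ ^ 2 * quad x := by simp [quad]; ring
      rw [this]
      exact mul_ne_zero (pow_ne_zero _ (inv_ne_zero h0)) hQ
    have hpy : ∀ o, polar4 (veronese q o) ((x 0)⁻¹ • x) = 0 ↔ polar4 (veronese q o) x = 0 := by
      intro o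
      have : polar4 (veronese q o) ((x 0)⁻¹ • x) = (x 0)⁻¹ * polar4 (veronese q o) x := by
        simp [polar4]; ring
      rw [this, mul_eq_zero]
      simp [h0]
    simp only [← hpy]
    have hy0 : ((x 0)⁻¹ • x) 0 = 1 := by simp [h0]
    generalize (x 0)⁻¹ • x = y at *
    obtain ⟨η, hη, hηq, hη2⟩ := exists_sqrt h hl hy hQy
    obtain ⟨t₁, t₂, hne, ht⟩ := exists_two_affine h (y 1) (y 2) (y 3) η hη hηq (by
      rw [hη2]; simp only [herm, quad, hy0, one_pow, one_mul, pow_succ])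
    have : {o : Option F | polar4 (veronese q o) y = 0} = {some t₁, some t₂} := by
      ext o
      rcases o with _ | t
      · simp [polar4, veronese, hy0]
      · simp only [Set.mem_ofPred_eq, Set.mem_insert_iff, Set.mem_singleton_iff,
          Option.some.injEq]
        rw [← ht]
        simp [polar4, veronese, hy0, pow_succ]
    rw [this, Set.ncard_pair (by simpa using hne)]

theorem ncard_pow_eq {n : ℕ} (hn : 0 < n) {ζ a : F} (hζ : IsPrimitiveRoot ζ n) (ha : a ≠ 0)
    (hr : ∃ b : F, b ^ n = a) : {x : F | x ^ n = a}.ncard = n := by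
  classical
  have e : {x : F | x ^ n = a} = ((Polynomial.nthRoots n a).toFinset : Set F) := by
    ext x; simp [Polynomial.mem_nthRoots hn]
  rw [e, Set.ncard_coe_finset, Multiset.toFinset_card_of_nodup (hζ.nthRoots_nodup ha),
    hζ.card_nthRoots, if_pos hr]

theorem ncard_slopes [Finite F] (h : QInvolution F q N) (hl : Admissible q N l γ) :
    (slopes q N γ).ncard = q + 1 := by
  have h0 := hl.ne_zero
  have hN : 0 < N := by have := h.two_mul; omega
  obtain ⟨ζ, hζ⟩ := hl.primitive
  have e : slopes q N γ = (fun x : F => -x) '' ({x | x ^ N = -l} ∪ {x | x ^ N = -l⁻¹}) := by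
    ext m
    rw [Set.image_neg_eq_neg]
    simp only [slopes, Set.mem_ofPred_eq, Set.mem_neg, Set.mem_union]
    have hm : m ^ (q + 1) = ((-m) ^ N) ^ 2 := by
      rw [← pow_mul, mul_comm N 2, (even_two_mul N).neg_pow, h.two_mul]
    have : m ^ (q + 1) + 1 + γ * (-m) ^ N = ((-m) ^ N + l) * ((-m) ^ N + l⁻¹) := by
      rw [hm, hl.eq]
      linear_combination -(mul_inv_cancel₀ h0)
    rw [this, mul_eq_zero, add_eq_zero_iff_eq_neg, add_eq_zero_iff_eq_neg]
  rw [e, Set.ncard_image_of_injective _ neg_injective, Set.ncard_union_eq,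
    ncard_pow_eq hN hζ (neg_ne_zero.2 h0) hl.root,
    ncard_pow_eq hN hζ (neg_ne_zero.2 (inv_ne_zero h0)) hl.root_inv]
  · have := h.two_mul; omega
  · rw [Set.disjoint_left]
    intro x hx hx'
    apply hl.sq_ne_one
    have : l = l⁻¹ := neg_injective (hx.symm.trans hx')
    rw [sq]
    nth_rw 2 [this]
    exact mul_inv_cancel₀ h0

theorem qInvolution_of_card [Fintype F] {p n : ℕ} (hp : p.Prime) (hodd : Odd p) (hn : 0 < n)
    (hq : q = p ^ n) (hF : Fintype.card F = q ^ 2) : QInvolution F q ((q + 1) / 2) := by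
  have : Fact p.Prime := ⟨hp⟩
  have : CharP F p := charP_of_card_eq_prime_pow (f := n * 2) (by rw [hF, hq, pow_mul])
  have hqodd : Odd q := hq ▸ hodd.pow
  have hp3 : 3 ≤ p := by
    have := hp.two_le
    rcases hodd with ⟨j, rfl⟩
    omega
  have hsub : ∀ x y : F, (x - y) ^ q = x ^ q - y ^ q := fun x y => by
    rw [hq, sub_pow_char_pow]
  refine ⟨?_, ?_, fun x y => ?_, hsub, fun x => hqodd.neg_pow x, fun x => ?_, ?_, ?_⟩
  · rcases hqodd with ⟨j, rfl⟩; omega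
  · rw [hq]; exact hp3.trans (Nat.le_self_pow hn.ne' p)
  · rw [hq, add_pow_char_pow]
  · rw [← pow_mul, ← sq, ← hF, FiniteField.pow_card]
  · have : ¬ ((2 : ℕ) : F) = 0 := by
      rw [CharP.cast_eq_zero_iff F p]
      intro hd
      have := Nat.le_of_dvd (by norm_num) hd
      omega
    simpa using this
  · rw [hq, Nat.cast_pow, CharP.cast_eq_zero, zero_pow hn.ne']

theorem orderOf_eq_card_sub_one [Fintype F] (hcard : 2 < Fintype.card F) {ξ : F}
    (hξ : ∀ x : F, x ≠ 0 → ∃ m : ℕ, x = ξ ^ m) : orderOf ξ = Fintype.card F - 1 := by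
  classical
  have h0 : ξ ≠ 0 := by
    rintro rfl
    obtain ⟨x, hx⟩ := Finset.exists_mem_notMem_of_card_lt_card
      (s := {0, 1}) (t := (Finset.univ : Finset F)) (by
        rw [Finset.card_univ]; exact Finset.card_le_two.trans_lt hcard)
    simp at hx
    obtain ⟨m, hm⟩ := hξ x hx.1
    rcases m with _ | m
    · exact hx.2 (by simpa using hm)
    · exact hx.1 (by simpa using hm)
  have : ∀ u : Fˣ, u ∈ Subgroup.zpowers (Units.mk0 ξ h0) := by
    intro u
    obtain ⟨m, hm⟩ := hξ u u.ne_zero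
    exact ⟨m, by ext; simp [hm]⟩
  have := orderOf_eq_card_of_forall_mem_zpowers this
  rw [← orderOf_units, Units.val_mk0] at this
  rw [this, Nat.card_units, Nat.card_eq_fintype_card]

theorem admissible_primitive_pow [Fintype F] (h : QInvolution F q N)
    (hF : Fintype.card F = q ^ 2) {ξ : F} (hξ : ∀ x : F, x ≠ 0 → ∃ m : ℕ, x = ξ ^ m)
    {k : ℕ} (hk1 : 1 ≤ k) (hkq : k ≤ q - 2) (hkne : k ≠ (q - 1) / 2) :
    Admissible q N (ξ ^ (k * N)) (ξ ^ (k * N) + (ξ ^ (k * N))⁻¹) := by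
  have hN := h.two_mul
  have h3 := h.three_le
  have hord := orderOf_eq_card_sub_one (by rw [hF]; nlinarith) hξ
  obtain ⟨r, hr⟩ : ∃ r, q = r + 1 := ⟨q - 1, by omega⟩
  have hcard : q ^ 2 - 1 = r * (2 * N) := by
    rw [hN, hr]
    have : (r + 1) ^ 2 = r * (r + 1 + 1) + 1 := by ring
    omega
  rw [hF, hcard] at hord
  obtain ⟨M, hM⟩ : ∃ M, r = 2 * M := ⟨N - 1, by omega⟩
  have hpos : 0 < r * (2 * N) := Nat.mul_pos (by omega) (by omega)
  have hprim : IsPrimitiveRoot ξ (r * (2 * N)) := hord ▸ IsPrimitiveRoot.orderOf ξ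
  have hξ0 : ξ ≠ 0 := hprim.ne_zero hpos.ne'
  have hneg : ξ ^ (r * N) = -1 := by
    have h1 : (ξ ^ (r * N)) ^ 2 = 1 := by
      rw [← pow_mul, mul_assoc, mul_comm N 2, hprim.pow_eq_one]
    rw [sq, mul_self_eq_one_iff] at h1
    rcases h1 with e | e
    · rw [hprim.pow_eq_one_iff_dvd] at e
      have := Nat.le_of_dvd (Nat.mul_pos (by omega) (by omega)) e
      have := Nat.le_of_mul_le_mul_left this (by omega : 0 < r)
      omega
    · exact e
  refine ⟨rfl, pow_ne_zero _ hξ0, ?_, ?_, ⟨(-1) ^ k, ?_, ?_⟩, ⟨ξ ^ (r + k), ?_⟩,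
    ⟨ξ ^ r * (ξ ^ k)⁻¹, ?_⟩, ⟨ξ ^ (r * 2), ?_⟩⟩
  · intro e
    rw [← pow_mul, hprim.pow_eq_one_iff_dvd, show k * N * 2 = k * (2 * N) by ring] at e
    have := Nat.le_of_dvd (by omega) (Nat.dvd_of_mul_dvd_mul_right (by omega) e)
    omega
  · intro e
    have e4 : ξ ^ (2 * k * (2 * N)) = 1 := by
      rw [show 2 * k * (2 * N) = k * N * 2 * 2 by ring, pow_mul, pow_mul _ (k * N) 2, e]; ring
    rw [hprim.pow_eq_one_iff_dvd] at e4
    obtain ⟨j, hj⟩ := Nat.dvd_of_mul_dvd_mul_right (by omega) e4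
    rw [hM, mul_assoc] at hj
    have hk : k = M * j := by omega
    have hj2 : j < 2 := by
      by_contra hcon
      have : M * 2 ≤ M * j := Nat.mul_le_mul_left M (by omega)
      omega
    interval_cases j <;> omega
  · rw [← pow_mul, mul_comm, pow_mul]; simp
  · rw [← hneg, ← pow_mul, ← pow_mul, ← pow_add, hr]
    congr 1; ring
  · rw [← pow_mul, add_mul, pow_add, hneg]; ring
  · rw [mul_pow, inv_pow, ← pow_mul, ← pow_mul, hneg]; ring
  · exact hprim.pow hpos (by ring)

/-- The set of points of the projective subspace attached to `W`. -/
def pointsOf (W : Submodule F (Fin 4 → F)) : Set (PGPoint F) := {P | P.rep ∈ W}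

theorem mk_mem_pointsOf (W : Submodule F (Fin 4 → F)) (v : Fin 4 → F) (hv : v ≠ 0) :
    Projectivization.mk F v hv ∈ pointsOf W ↔ v ∈ W := by
  obtain ⟨a, ha⟩ := (Projectivization.mk_eq_mk_iff' F _ _
    (Projectivization.rep_nonzero (Projectivization.mk F v hv)) hv).1
    (Projectivization.mk_rep _)
  have ha0 : a ≠ 0 := by
    rintro rfl
    exact Projectivization.rep_nonzero (Projectivization.mk F v hv) (by simpa using ha.symm)
  change (Projectivization.mk F v hv).rep ∈ W ↔ _
  rw [← ha, W.smul_mem_iff ha0]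

theorem mk_mem_Cgam_s11 (h : QInvolution F q N) (v : Fin 4 → F) (hv : v ≠ 0) :
    Projectivization.mk F v hv ∈ Cgam q γ ↔ Fgam q γ v = 0 := by
  constructor
  · intro H
    exact H v hv rfl
  · intro H w hw e
    obtain ⟨a, ha⟩ := (Projectivization.mk_eq_mk_iff' F _ _ hw hv).1 e.symm
    rw [← ha, Fgam_smul h, H, mul_zero]

theorem pointsOf_subset_Cgam_iff (h : QInvolution F q N) (W : Submodule F (Fin 4 → F)) :
    pointsOf W ⊆ Cgam q γ ↔ ∀ v ∈ W, Fgam q γ v = 0 := by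
  constructor
  · intro H v hv
    by_cases hv0 : v = 0
    · have := Fgam_smul (γ := γ) h 0 v
      simpa [hv0] using this
    · exact (mk_mem_Cgam_s11 h v hv0).1 (H ((mk_mem_pointsOf W v hv0).2 hv))
  · intro H P hP
    rw [← P.mk_rep]
    exact (mk_mem_Cgam_s11 h _ P.rep_nonzero).2 (H _ hP)

theorem pointsOf_injective : Function.Injective (pointsOf (F := F)) := by
  intro W W' e
  ext v
  by_cases hv : v = 0
  · simp [hv]
  · rw [← mk_mem_pointsOf W v hv, e, mk_mem_pointsOf]

theorem isLine_subset_Cgam_iff [Fintype F] (h : QInvolution F q N)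
    (hF : Fintype.card F = q ^ 2) (hγ : γ ≠ 0) (ℓ : Set (PGPoint F)) :
    IsLine ℓ ∧ ℓ ⊆ Cgam q γ ↔
      ∃ o, ∃ m ∈ slopes q N γ, ℓ = pointsOf (tangentLine q o m) := by
  constructor
  · rintro ⟨⟨W, hW, rfl⟩, H⟩
    obtain ⟨o, m, hm, rfl⟩ :=
      exists_tangentLine_eq h hF hγ W hW ((pointsOf_subset_Cgam_iff h W).1 H)
    exact ⟨o, m, hm, rfl⟩
  · rintro ⟨o, m, hm, rfl⟩
    exact ⟨⟨_, finrank_tangentLine o m, rfl⟩, (pointsOf_subset_Cgam_iff h _).2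
      fun v hv => Fgam_eq_zero_of_mem_tangentLine h hm hv⟩

theorem mem_Oset_iff_s11 (P : PGPoint F) :
    P ∈ Oset F q ↔ ∃ o, P = Projectivization.mk F (veronese q o) (veronese_ne_zero o) := by
  constructor
  · rintro (⟨t, hv, rfl⟩ | ⟨hv, rfl⟩)
    · exact ⟨some t, rfl⟩
    · exact ⟨none, rfl⟩
  · rintro ⟨_ | t, rfl⟩
    · exact Or.inr ⟨_, rfl⟩
    · exact Or.inl ⟨t, _, rfl⟩

theorem quad_rep_ne_zero (h : QInvolution F q N) {P : PGPoint F} (hP : P ∈ Cgam q γ)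
    (hO : P ∉ Oset F q) : quad P.rep ≠ 0 := by
  intro hQ
  rw [← P.mk_rep, mk_mem_Cgam_s11 h] at hP
  obtain ⟨o, a, -, ha⟩ := exists_veronese h _ P.rep_nonzero hQ hP
  apply hO
  rw [mem_Oset_iff_s11]
  refine ⟨o, ?_⟩
  conv_lhs => rw [← P.mk_rep]
  exact (Projectivization.mk_eq_mk_iff' F _ _ _ _).2 ⟨a, ha.symm⟩

theorem mk_veronese_mem_SigmaSet (h : QInvolution F q N) (o : Option F) :
    Projectivization.mk F (veronese q o) (veronese_ne_zero o) ∈ SigmaSet F q := by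
  have hq0 : q ≠ 0 := by have := h.three_le; omega
  rcases o with _ | t
  · refine ⟨0, 0, 1, ?_, ?_, ?_, ?_⟩
    · intro e; simpa using congrFun e 3
    · simp [hq0]
    · simp
    · simp [veronese, hq0]
  · refine ⟨1, t, t ^ (q + 1), ?_, ?_, ?_, ?_⟩
    · intro e; simpa using congrFun e 0
    · simp
    · rw [pow_succ, mul_pow, h.invol, mul_comm]
    · rfl

theorem mem_Oset_of_mem_SigmaSet (h : QInvolution F q N) (hl : Admissible q N l γ)
    {P : PGPoint F} (hP : P ∈ Cgam q γ) (hS : P ∈ SigmaSet F q) : P ∈ Oset F q := by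
  by_contra hO
  have hQ := quad_rep_ne_zero h hP hO
  have hx : Fgam q γ P.rep = 0 := by rwa [← P.mk_rep, mk_mem_Cgam_s11 h] at hP
  obtain ⟨η, hη, -, hη2⟩ := exists_sqrt h hl hx hQ
  obtain ⟨a, b, c, hv, ha, hc, e⟩ := hS
  obtain ⟨s, hs⟩ := (Projectivization.mk_eq_mk_iff' F _ _ P.rep_nonzero hv).1
    (P.mk_rep.trans e)
  apply hη
  rw [← hs] at hη2
  have : η ^ 2 = 0 := by
    rw [hη2]
    simp [herm, quad, pow_succ, h.sub, mul_pow, h.invol, ha, hc]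
    ring
  simpa using this

end Helpers

/-- Lemma 2.12: the set `L_k` of `(q+1)(q²+1)` lines contained in `E_k`; through
    each point of `E_k \ O` pass two of them, through each point of `O` pass `q+1`
    of them, and each of them meets `Σ` in exactly one point. -/
theorem stmt11 {F : Type*} [Field F] [Fintype F] (p n q : ℕ) (hp : p.Prime)
    (hodd : Odd p) (hn : 0 < n) (hq : q = p ^ n) (hF : Fintype.card F = q ^ 2)
    (ξ : F) (hξ : ∀ x : F, x ≠ 0 → ∃ m : ℕ, x = ξ ^ m)
    (k : ℕ) (hk1 : 1 ≤ k) (hkq : k ≤ q - 2) (hkne : k ≠ (q - 1) / 2) :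
    {ℓ : Set (PGPoint F) | IsLine ℓ ∧
        ℓ ⊆ Cgam q (ξ ^ (k * (q + 1) / 2) + (ξ ^ (k * (q + 1) / 2))⁻¹)}.ncard
      = (q + 1) * (q ^ 2 + 1) ∧
    (∀ P ∈ Cgam q (ξ ^ (k * (q + 1) / 2) + (ξ ^ (k * (q + 1) / 2))⁻¹) \ Oset F q,
      {ℓ : Set (PGPoint F) | IsLine ℓ ∧
        ℓ ⊆ Cgam q (ξ ^ (k * (q + 1) / 2) + (ξ ^ (k * (q + 1) / 2))⁻¹) ∧
        P ∈ ℓ}.ncard = 2) ∧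
    (∀ P ∈ Oset F q,
      {ℓ : Set (PGPoint F) | IsLine ℓ ∧
        ℓ ⊆ Cgam q (ξ ^ (k * (q + 1) / 2) + (ξ ^ (k * (q + 1) / 2))⁻¹) ∧
        P ∈ ℓ}.ncard = q + 1) ∧
    (∀ ℓ : Set (PGPoint F), IsLine ℓ →
      ℓ ⊆ Cgam q (ξ ^ (k * (q + 1) / 2) + (ξ ^ (k * (q + 1) / 2))⁻¹) →
      (ℓ ∩ SigmaSet F q).ncard = 1) := by
  have h := qInvolution_of_card hp hodd hn hq hF
  have hk : k * (q + 1) / 2 = k * ((q + 1) / 2) := by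
    have := h.two_mul
    exact Nat.mul_div_assoc k ⟨(q + 1) / 2, this.symm⟩
  rw [hk]
  have hl := admissible_primitive_pow h hF hξ hk1 hkq hkne
  generalize ξ ^ (k * ((q + 1) / 2)) + (ξ ^ (k * ((q + 1) / 2)))⁻¹ = γ at hl ⊢
  generalize ξ ^ (k * ((q + 1) / 2)) = l at hl
  generalize (q + 1) / 2 = N at h hl
  have hlines := isLine_subset_Cgam_iff h hF hl.gamma_ne_zero
  have hcard := ncard_slopes h hl
  have hinj : ∀ o o' m m', pointsOf (tangentLine q o m) = pointsOf (tangentLine q o' m') →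
      o = o' ∧ m = m' := fun o o' m m' e => tangentLine_injective h (pointsOf_injective e)
  refine ⟨?_, ?_, ?_, ?_⟩
  · have e : {ℓ : Set (PGPoint F) | IsLine ℓ ∧ ℓ ⊆ Cgam q γ} =
        (fun x : Option F × F => pointsOf (tangentLine q x.1 x.2)) ''
          (Set.univ ×ˢ slopes q N γ) := by
      ext ℓ
      simp only [Set.mem_ofPred_eq, hlines, Set.mem_image, Set.mem_prod, Set.mem_univ, true_and,
        Prod.exists]
      exact ⟨fun ⟨o, m, hm, e⟩ => ⟨o, m, hm, e.symm⟩, fun ⟨o, m, hm, e⟩ => ⟨o, m, hm, e.symm⟩⟩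
    rw [e, Set.InjOn.ncard_image, Set.ncard_prod, hcard, Set.ncard_univ, Nat.card_eq_fintype_card,
      Fintype.card_option, hF, mul_comm]
    rintro ⟨o, m⟩ - ⟨o', m'⟩ - e
    exact Prod.ext_iff.2 (hinj _ _ _ _ e)
  · rintro P ⟨hP, hO⟩
    have hx : Fgam q γ P.rep = 0 := by rwa [← P.mk_rep, mk_mem_Cgam_s11 h] at hP
    have hQ := quad_rep_ne_zero h hP hO
    have hne : ∀ o (a : F), P.rep ≠ a • veronese q o := by
      intro o a e
      apply hQ
      rw [e]
      have : quad (a • veronese q o) = a ^ 2 * quad (veronese q o) := by simp [quad]; ring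
      rw [this, quad_veronese, mul_zero]
    have hex : ∀ o, polar4 (veronese q o) P.rep = 0 →
        ∃ m ∈ slopes q N γ, P.rep ∈ tangentLine q o m := fun o ho => by
      obtain ⟨m, hm, hPm, -⟩ := exists_slope h ho hx (hne o)
      exact ⟨m, hm, hPm⟩
    choose! f hf hPf using hex
    have huniq : ∀ o m, P.rep ∈ tangentLine q o m → m = f o := by
      intro o m hm
      have ho := polar_eq_zero_of_mem_tangentLine hm
      obtain ⟨a, c, e⟩ := (mem_tangentLine_iff _ _ _).1 hm
      obtain ⟨a', c', e'⟩ := (mem_tangentLine_iff _ _ _).1 (hPf o ho)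
      have hc : c ≠ 0 := by
        rintro rfl
        apply hne o a
        rw [e]
        cases o <;> ext i <;> fin_cases i <;> simp [tangentVec]
      rw [e, veronese_tangentVec_eq_iff] at e'
      apply mul_left_cancel₀ hc
      rw [e'.2.1, e'.2.2]
    rw [← ncard_polar_eq_zero h hl hx hQ]
    have e : {ℓ : Set (PGPoint F) | IsLine ℓ ∧ ℓ ⊆ Cgam q γ ∧ P ∈ ℓ} =
        (fun o => pointsOf (tangentLine q o (f o))) ''
          {o : Option F | polar4 (veronese q o) P.rep = 0} := by
      ext ℓ
      simp only [Set.mem_ofPred_eq, ← and_assoc, hlines, Set.mem_image]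
      constructor
      · rintro ⟨⟨o, m, hm, rfl⟩, hPm⟩
        exact ⟨o, polar_eq_zero_of_mem_tangentLine hPm, by rw [huniq o m hPm]⟩
      · rintro ⟨o, ho, rfl⟩
        exact ⟨⟨o, f o, hf o ho, rfl⟩, hPf o ho⟩
    rw [e, Set.InjOn.ncard_image]
    intro o _ o' _ e
    exact (hinj _ _ _ _ e).1
  · intro P hP
    obtain ⟨o, rfl⟩ := (mem_Oset_iff_s11 P).1 hP
    have e : {ℓ : Set (PGPoint F) | IsLine ℓ ∧ ℓ ⊆ Cgam q γ ∧
        Projectivization.mk F (veronese q o) (veronese_ne_zero o) ∈ ℓ} =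
        (fun m => pointsOf (tangentLine q o m)) '' slopes q N γ := by
      ext ℓ
      simp only [Set.mem_ofPred_eq, ← and_assoc, hlines, Set.mem_image]
      constructor
      · rintro ⟨⟨o', m, hm, rfl⟩, hPm⟩
        rw [mk_mem_pointsOf] at hPm
        obtain rfl := eq_of_veronese_mem_tangentLine h hPm
        exact ⟨m, hm, rfl⟩
      · rintro ⟨m, hm, rfl⟩
        exact ⟨⟨o, m, hm, rfl⟩,
          (mk_mem_pointsOf _ _ _).2 (veronese_mem_tangentLine o m)⟩
    rw [e, Set.InjOn.ncard_image, hcard]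
    intro m _ m' _ e
    exact (hinj _ _ _ _ e).2
  · intro ℓ hℓ hsub
    obtain ⟨o, m, hm, rfl⟩ := (hlines ℓ).1 ⟨hℓ, hsub⟩
    rw [Set.ncard_eq_one]
    refine ⟨Projectivization.mk F (veronese q o) (veronese_ne_zero o), ?_⟩
    ext P
    rw [Set.mem_singleton_iff]
    constructor
    · rintro ⟨hPl, hPS⟩
      obtain ⟨o', rfl⟩ := (mem_Oset_iff_s11 P).1 (mem_Oset_of_mem_SigmaSet h hl (hsub hPl) hPS)
      rw [mk_mem_pointsOf] at hPl
      obtain rfl := eq_of_veronese_mem_tangentLine h hPl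
      rfl
    · rintro rfl
      exact ⟨(mk_mem_pointsOf _ _ _).2 (veronese_mem_tangentLine o m), mk_veronese_mem_SigmaSet h o⟩
end
end

section
/- Let q be an odd prime power and ξ a primitive element of 𝔽_{q²}. For i, j ∈ {1,…,q} with i, j ≠ (q+1)/2, no point of the hyperbolic quadric Q⁺(3,q²) satisfies ξ^j X₁^{q+1} + X₂^{q+1} + ξ^{i+j} X₃^{q+1} + ξ^i X₄^{q+1} = 0; that is, the set X_j of points of PG(3,q²) satisfying this equation is disjoint from Q⁺(3,q²). -/
noncomputable section

open Matrix

/-- A nonzero element whose powers exhaust the nonzero elements of a finite field has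
multiplicative order `|F| - 1`. -/
theorem orderOf_eq_card_sub_one_of_forall_exists_pow {F : Type*} [Field F] [Fintype F] {ξ : F}
    (h0 : ξ ≠ 0) (hξ : ∀ x : F, x ≠ 0 → ∃ m : ℕ, x = ξ ^ m) :
    orderOf ξ = Fintype.card F - 1 := by
  classical
  have h : orderOf (Units.mk0 ξ h0) = Nat.card Fˣ := by
    refine orderOf_eq_card_of_forall_mem_zpowers fun x => ?_
    obtain ⟨m, hm⟩ := hξ x x.ne_zero
    exact ⟨m, Units.ext (by simp [hm])⟩
  rw [← orderOf_units, Units.val_mk0, Nat.card_eq_fintype_card, Fintype.card_units] at h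
  exact h

/-- The diagonal binary form `x^{q+1} + a y^{q+1}` over `𝔽_{q²}`, with `q` odd, is anisotropic
as soon as `a` is not a nonzero element of `𝔽_q`. -/
theorem eq_zero_of_pow_add_mul_pow_eq_zero {F : Type*} [Field F] [Fintype F] {q : ℕ}
    (hq : Odd q) (hF : Fintype.card F = q ^ 2) {a : F} (ha0 : a ≠ 0) (ha : a ^ (q - 1) ≠ 1)
    {x y : F} (h : x ^ (q + 1) + a * y ^ (q + 1) = 0) : x = 0 ∧ y = 0 := by
  have norm_pow (z : F) (hz : z ≠ 0) : (z ^ (q + 1)) ^ (q - 1) = 1 := by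
    rw [← pow_mul, ← Nat.sq_sub_sq, one_pow, ← hF]
    exact FiniteField.pow_card_sub_one_eq_one z hz
  have even_sub : Even (q - 1) := Nat.Odd.sub_odd hq odd_one
  by_cases hy : y = 0
  · subst hy
    exact ⟨by simpa using h, rfl⟩
  · have hx : x ≠ 0 := by
      rintro rfl
      simp [ha0, hy] at h
    refine absurd ?_ ha
    have e := congrArg (· ^ (q - 1)) (eq_neg_of_add_eq_zero_right h)
    simpa only [mul_pow, norm_pow y hy, even_sub.neg_pow, norm_pow x hx, mul_one] using e

/-- Lemma 2.15: the variety `X_j : ξ^j X₁^{q+1} + X₂^{q+1} + ξ^{i+j} X₃^{q+1}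
    + ξ^i X₄^{q+1} = 0` is disjoint from `Q⁺(3,q²)`. -/
theorem stmt13 {F : Type*} [Field F] [Fintype F] (p n q : ℕ) (hp : p.Prime)
    (hodd : Odd p) (hn : 0 < n) (hq : q = p ^ n) (hF : Fintype.card F = q ^ 2)
    (ξ : F) (hξ : ∀ x : F, x ≠ 0 → ∃ m : ℕ, x = ξ ^ m)
    (i j : ℕ) (hi1 : 1 ≤ i) (hiq : i ≤ q) (hine : i ≠ (q + 1) / 2)
    (hj1 : 1 ≤ j) (hjq : j ≤ q) (hjne : j ≠ (q + 1) / 2) :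
    {P : PGPoint F | ∀ (v : Fin 4 → F) (hv : v ≠ 0),
        P = Projectivization.mk F v hv →
        ξ ^ j * v 0 ^ (q + 1) + v 1 ^ (q + 1) + ξ ^ (i + j) * v 2 ^ (q + 1)
          + ξ ^ i * v 3 ^ (q + 1) = 0} ∩ Qplus F = ∅ := by
  have hq3 : 3 ≤ q := by
    have hp3 : 3 ≤ p := by
      obtain ⟨k, rfl⟩ := hodd
      have := hp.two_le
      omega
    exact hq ▸ hp3.trans (Nat.le_self_pow hn.ne' p)
  have hq_odd : Odd q := hq ▸ hodd.pow
  have h0 : ξ ≠ 0 := by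
    rintro rfl
    have one_of_ne (x : F) (hx : x ≠ 0) : x = 1 := by
      obtain ⟨m, rfl⟩ := hξ x hx
      rcases m with _ | m
      · exact pow_zero 0
      · simp at hx
    have : Fintype.card F ≤ 2 := by
      classical
      refine (Finset.card_le_card (t := {0, 1}) fun x _ => ?_).trans Finset.card_le_two
      by_cases hx : x = 0
      · simp [hx]
      · simp [one_of_ne x hx]
    nlinarith
  have hord : orderOf ξ = (q + 1) * (q - 1) := by
    rw [orderOf_eq_card_sub_one_of_forall_exists_pow h0 hξ, hF, ← Nat.sq_sub_sq, one_pow]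
  have aniso (k : ℕ) (hk1 : 1 ≤ k) (hkq : k ≤ q) {x y : F}
      (h : x ^ (q + 1) + ξ ^ k * y ^ (q + 1) = 0) : x = 0 ∧ y = 0 := by
    refine eq_zero_of_pow_add_mul_pow_eq_zero hq_odd hF (pow_ne_zero k h0) (fun e => ?_) h
    rw [← pow_mul, ← orderOf_dvd_iff_pow_eq_one, hord] at e
    have := Nat.le_of_dvd hk1 (Nat.dvd_of_mul_dvd_mul_right (by omega) e)
    omega
  rw [Set.eq_empty_iff_forall_notMem]
  rintro P ⟨hX, hQ⟩
  have hP : P = Projectivization.mk F P.rep P.rep_nonzero := P.mk_rep.symm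
  have hv := P.rep_nonzero
  have hX := hX _ hv hP
  have hQ := hQ _ hv hP
  generalize P.rep = v at hv hX hQ
  have hQ' : v 0 * v 3 = v 1 * v 2 := sub_eq_zero.mp hQ
  have hN : v 0 ^ (q + 1) * v 3 ^ (q + 1) = v 1 ^ (q + 1) * v 2 ^ (q + 1) := by
    rw [← mul_pow, hQ', mul_pow]
  apply hv
  have hprod : (v 0 ^ (q + 1) + ξ ^ i * v 2 ^ (q + 1)) *
      (v 1 ^ (q + 1) + ξ ^ j * v 0 ^ (q + 1)) = 0 := by
    linear_combination v 0 ^ (q + 1) * hX - ξ ^ i * hN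
  have v0 : v 0 = 0 := by
    rcases mul_eq_zero.mp hprod with h | h
    · exact (aniso i hi1 hiq h).1
    · exact (aniso j hj1 hjq h).2
  have hv12 : v 1 = 0 ∨ v 2 = 0 := by simpa [v0, eq_comm] using hQ'
  have hrest : v 1 = 0 ∧ v 2 = 0 ∧ v 3 = 0 := by
    rcases hv12 with h1 | h2
    · have h : ξ ^ i * (v 3 ^ (q + 1) + ξ ^ j * v 2 ^ (q + 1)) = 0 := by
        simp only [v0, h1, zero_pow (Nat.succ_ne_zero q)] at hX
        linear_combination hX
      have := aniso j hj1 hjq ((mul_eq_zero.mp h).resolve_left (pow_ne_zero i h0))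
      exact ⟨h1, this.2, this.1⟩
    · have h : v 1 ^ (q + 1) + ξ ^ i * v 3 ^ (q + 1) = 0 := by
        simp only [v0, h2, zero_pow (Nat.succ_ne_zero q)] at hX
        linear_combination hX
      have := aniso i hi1 hiq h
      exact ⟨this.1, h2, this.2⟩
  funext k
  fin_cases k
  exacts [v0, hrest.1, hrest.2.1, hrest.2.2]
end
end

section
/- Let q be an odd prime power, s a non-square of 𝔽_q, and 𝐢 ∈ 𝔽_{q²} with 𝐢² = s. Fix i, j ∈ {1,…,q} with i, j ≠ (q+1)/2 and write ξ^m = ξ₀^m + 𝐢 ξ₁^m with ξ₀^m, ξ₁^m ∈ 𝔽_q. For α, β ∈ 𝔽_q put A = α ξ₀^j + β ξ₁^j, C = α(ξ₀^i ξ₀^j + s ξ₁^i ξ₁^j) + β(ξ₀^j ξ₁^i + ξ₀^i ξ₁^j), D = α ξ₀^i + β ξ₁^i, and let M_{α,β} be the symmetric 8×8 matrix over 𝔽_q with rows (A,0,0,0,0,0,0,1), (0,−sA,0,0,0,0,1,0), (0,0,α,0,0,−1,0,0), (0,0,0,−sα,−1,0,0,0), (0,0,0,−1,C,0,0,0), (0,0,−1,0,0,−sC,0,0),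 (0,1,0,0,0,0,D,0), (1,0,0,0,0,0,0,−sD). Then det(M_{α,β}) = (sAD+1)²(sαC+1)², and the rank of M_{α,β} is either 6 or 8; it is 8 exactly when (sAD+1)(sαC+1) ≠ 0. -/
noncomputable section

open Matrix

/-- If every nonzero element of a finite field is a power of `ξ`, then any positive exponent `k`
with `ξ ^ k = 1` is at least `|F| - 1`. -/
theorem card_le_of_pow_eq_one {F : Type*} [Field F] [Fintype F] {ξ : F}
    (hξ : ∀ x : F, x ≠ 0 → ∃ m : ℕ, x = ξ ^ m) {k : ℕ} (hk : 0 < k) (h : ξ ^ k = 1) :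
    Fintype.card F ≤ k + 1 := by
  classical
  have hsub : (Finset.univ : Finset F) ⊆ insert 0 ((Finset.range k).image (ξ ^ ·)) := by
    intro x _
    rcases eq_or_ne x 0 with rfl | hx
    · exact Finset.mem_insert_self _ _
    · obtain ⟨m, rfl⟩ := hξ x hx
      exact Finset.mem_insert_of_mem (Finset.mem_image.2
        ⟨m % k, Finset.mem_range.2 (Nat.mod_lt _ hk), (pow_eq_pow_mod m h).symm⟩)
  calc Fintype.card F ≤ _ := Finset.card_le_card hsub
    _ ≤ ((Finset.range k).image (ξ ^ ·)).card + 1 := Finset.card_insert_le _ _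
    _ ≤ k + 1 := by
      gcongr
      simpa using Finset.card_image_le (s := Finset.range k) (f := (ξ ^ ·))

/-- A power `ξ ^ i` of a primitive element of `𝔽_{q²}` with `1 ≤ i ≤ q` is not in `𝔽_q`. -/
theorem pow_not_fixed {F : Type*} [Field F] [Fintype F] {q : ℕ} (hq : 2 < q)
    (hF : Fintype.card F = q ^ 2) {ξ : F} (hξ : ∀ x : F, x ≠ 0 → ∃ m : ℕ, x = ξ ^ m)
    {i : ℕ} (hi : 1 ≤ i) (hiq : i ≤ q) : (ξ ^ i) ^ q ≠ ξ ^ i := by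
  intro h
  obtain ⟨r, rfl⟩ : ∃ r, q = r + 1 := ⟨q - 1, by omega⟩
  have hξ0 : ξ ≠ 0 := by
    rintro rfl
    have hsub : (Finset.univ : Finset F).card ≤ 2 := by
      classical
      refine (Finset.card_le_card (t := {0, 1}) fun x _ => ?_).trans Finset.card_le_two
      rcases eq_or_ne x 0 with rfl | hx
      · simp
      · obtain ⟨m, rfl⟩ := hξ x hx
        rcases Nat.eq_zero_or_pos m with rfl | hm
        · simp
        · simp [zero_pow hm.ne']
    rw [Finset.card_univ, hF] at hsub
    nlinarith
  have h1 : ξ ^ (i * r) = 1 := by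
    rw [pow_succ, ← pow_mul] at h
    exact (mul_eq_right₀ (pow_ne_zero i hξ0)).1 h
  have := card_le_of_pow_eq_one hξ (Nat.mul_pos hi (by omega)) h1
  rw [hF] at this
  nlinarith [Nat.mul_le_mul_right r hiq]

/-- A symmetric `8 × 8` matrix supported on the diagonal and the antidiagonal. -/
def bandMatrix {F : Type*} [Field F] (s α A C D : F) : Matrix (Fin 8) (Fin 8) F :=
  Matrix.of
    ![![A, 0, 0, 0, 0, 0, 0, 1],
      ![0, -(s * A), 0, 0, 0, 0, 1, 0],
      ![0, 0, α, 0, 0, -1, 0, 0],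
      ![0, 0, 0, -(s * α), -1, 0, 0, 0],
      ![0, 0, 0, -1, C, 0, 0, 0],
      ![0, 0, -1, 0, 0, -(s * C), 0, 0],
      ![0, 1, 0, 0, 0, 0, D, 0],
      ![1, 0, 0, 0, 0, 0, 0, -(s * D)]]

/-- The unipotent upper triangular matrix with entries `a, b, c, d` on the upper half
of the antidiagonal. -/
def antiUnipotent {F : Type*} [Field F] (a b c d : F) : Matrix (Fin 8) (Fin 8) F :=
  Matrix.of
    ![![1, 0, 0, 0, 0, 0, 0, a],
      ![0, 1, 0, 0, 0, 0, b, 0],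
      ![0, 0, 1, 0, 0, c, 0, 0],
      ![0, 0, 0, 1, d, 0, 0, 0],
      ![0, 0, 0, 0, 1, 0, 0, 0],
      ![0, 0, 0, 0, 0, 1, 0, 0],
      ![0, 0, 0, 0, 0, 0, 1, 0],
      ![0, 0, 0, 0, 0, 0, 0, 1]]

theorem det_antiUnipotent {F : Type*} [Field F] (a b c d : F) :
    (antiUnipotent a b c d).det = 1 := by
  rw [Matrix.det_of_isUpperTriangular]
  · simp [antiUnipotent, Fin.prod_univ_succ]
  · intro i j hij
    fin_cases i <;> fin_cases j <;> first | rfl | simp at hij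

/-- The diagonal of the diagonal form of `bandMatrix` when `x = s A D + 1`, `y = s α C + 1`. -/
def bandDiagonal {F : Type*} [Field F] (x y : F) : Fin 8 → F :=
  ![x, x, -y, -y, -1, -1, 1, 1]

theorem mul_diagonal_submatrix_apply {F m : Type*} [Field F] [Fintype m] [DecidableEq m]
    (L : Matrix m m F) (v : m → F) (σ : Equiv.Perm m) (i j : m) :
    (L * (Matrix.diagonal v).submatrix id σ) i j = L i (σ j) * v (σ j) := by
  simp [Matrix.mul_apply, Matrix.diagonal_apply]

theorem bandMatrix_eq_mul {F : Type*} [Field F] (s α A C D : F) :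
    bandMatrix s α A C D =
      antiUnipotent A (-(s * A)) (-α) (s * α) *
        (Matrix.diagonal (bandDiagonal (s * A * D + 1) (s * α * C + 1))).submatrix id Fin.revPerm *
        antiUnipotent (-(s * D)) D (s * C) (-C) := by
  ext i j
  rw [Matrix.mul_apply]
  simp only [mul_diagonal_submatrix_apply, Fin.sum_univ_eight, Fin.revPerm_apply]
  fin_cases i <;> fin_cases j <;>
    simp [bandMatrix, antiUnipotent, bandDiagonal, Fin.rev] <;> ring

theorem det_bandMatrix {F : Type*} [Field F] (s α A C D : F) :
    (bandMatrix s α A C D).det = (s * A * D + 1) ^ 2 * (s * α * C + 1) ^ 2 := by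
  have hsign : Equiv.Perm.sign (Fin.revPerm : Equiv.Perm (Fin 8)) = 1 := by decide
  rw [bandMatrix_eq_mul, Matrix.det_mul, Matrix.det_mul, det_antiUnipotent, det_antiUnipotent,
    Matrix.det_permute', hsign, Matrix.det_diagonal]
  simp [bandDiagonal, Fin.prod_univ_succ]
  ring

open Classical in
theorem rank_bandMatrix {F : Type*} [Field F] (s α A C D : F) :
    (bandMatrix s α A C D).rank =
      4 + (if s * A * D + 1 = 0 then 0 else 2) + (if s * α * C + 1 = 0 then 0 else 2) := by
  have hrank : (bandMatrix s α A C D).rank =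
      (Matrix.diagonal (bandDiagonal (s * A * D + 1) (s * α * C + 1))).rank := by
    rw [bandMatrix_eq_mul, Matrix.rank_mul_eq_left_of_isUnit_det,
      Matrix.rank_mul_eq_right_of_isUnit_det]
    · exact Matrix.rank_submatrix _ (Equiv.refl _) Fin.revPerm
    all_goals simp [det_antiUnipotent]
  rw [hrank, Matrix.rank_diagonal, Fintype.card_subtype, Finset.card_filter]
  simp only [bandDiagonal, Fin.sum_univ_eight]
  by_cases hx : s * A * D + 1 = 0 <;> by_cases hy : s * α * C + 1 = 0 <;> simp [hx, hy, -neg_add_rev]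

/-- Lemma 2.21 and its proof: `det(M_{α,β}) = (sAD+1)²(sαC+1)²`, the rank of
    `M_{α,β}` is 6 or 8, and it is 8 exactly when `(sAD+1)(sαC+1) ≠ 0`.
    Here `𝔽_q` is realised inside `F = 𝔽_{q²}` as the fixed field of `x ↦ x^q`. -/
theorem stmt15 {F : Type*} [Field F] [Fintype F] (p n q : ℕ) (hp : p.Prime)
    (hodd : Odd p) (hn : 0 < n) (hq : q = p ^ n) (hF : Fintype.card F = q ^ 2)
    (s im : F) (hs : s ^ q = s) (hsns : ¬ ∃ y : F, y ^ q = y ∧ y ^ 2 = s)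
    (him : im ^ 2 = s)
    (ξ : F) (hξ : ∀ x : F, x ≠ 0 → ∃ m : ℕ, x = ξ ^ m)
    (i j : ℕ) (hi1 : 1 ≤ i) (hiq : i ≤ q) (hine : i ≠ (q + 1) / 2)
    (hj1 : 1 ≤ j) (hjq : j ≤ q) (hjne : j ≠ (q + 1) / 2)
    (ξ0i ξ1i ξ0j ξ1j : F)
    (h0i : ξ0i ^ q = ξ0i) (h1i : ξ1i ^ q = ξ1i)
    (h0j : ξ0j ^ q = ξ0j) (h1j : ξ1j ^ q = ξ1j)
    (hdi : ξ ^ i = ξ0i + im * ξ1i) (hdj : ξ ^ j = ξ0j + im * ξ1j)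
    (α β : F) (hα : α ^ q = α) (hβ : β ^ q = β) :
    let A : F := α * ξ0j + β * ξ1j
    let C : F := α * (ξ0i * ξ0j + s * ξ1i * ξ1j) + β * (ξ0j * ξ1i + ξ0i * ξ1j)
    let D : F := α * ξ0i + β * ξ1i
    let M : Matrix (Fin 8) (Fin 8) F := Matrix.of
      ![![A, 0, 0, 0, 0, 0, 0, 1],
        ![0, -(s * A), 0, 0, 0, 0, 1, 0],
        ![0, 0, α, 0, 0, -1, 0, 0],
        ![0, 0, 0, -(s * α), -1, 0, 0, 0],
        ![0, 0, 0, -1, C, 0, 0, 0],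
        ![0, 0, -1, 0, 0, -(s * C), 0, 0],
        ![0, 1, 0, 0, 0, 0, D, 0],
        ![1, 0, 0, 0, 0, 0, 0, -(s * D)]]
    M.det = (s * A * D + 1) ^ 2 * (s * α * C + 1) ^ 2 ∧
      (M.rank = 6 ∨ M.rank = 8) ∧
      (M.rank = 8 ↔ (s * A * D + 1) * (s * α * C + 1) ≠ 0) := by
  intro A C D M
  have hq2 : 2 < q := by
    have hp3 : 2 < p := lt_of_le_of_ne hp.two_le fun h => by subst h; exact absurd hodd (by decide)
    exact hp3.trans_le (hq ▸ Nat.le_self_pow hn.ne' p)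
  have him_ne {k : ℕ} {a b : F} (hk : 1 ≤ k) (hkq : k ≤ q) (ha : a ^ q = a)
      (hd : ξ ^ k = a + im * b) : b ≠ 0 := by
    rintro rfl
    refine pow_not_fixed hq2 hF hξ hk hkq ?_
    rw [hd, mul_zero, add_zero, ha]
  have hs0 : s ≠ 0 := fun h => hsns ⟨0, zero_pow (by omega), by simp [h]⟩
  have hnot : ¬ (s * A * D + 1 = 0 ∧ s * α * C + 1 = 0) := by
    rintro ⟨h1, h2⟩
    have hmul : s * (ξ1i * ξ1j) * (β ^ 2 - s * α ^ 2) = 0 := by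
      linear_combination h1 - h2
    have hsq : β ^ 2 = s * α ^ 2 := by
      have h3 : s * (ξ1i * ξ1j) ≠ 0 := mul_ne_zero hs0
        (mul_ne_zero (him_ne hi1 hiq h0i hdi) (him_ne hj1 hjq h0j hdj))
      exact sub_eq_zero.1 ((mul_eq_zero.1 hmul).resolve_left h3)
    have hα0 : α ≠ 0 := fun h => by simp [h] at h2
    refine hsns ⟨β / α, by rw [div_pow, hβ, hα], ?_⟩
    rw [div_pow, hsq]
    field_simp
  have hrank : M.rank = _ := rank_bandMatrix s α A C D
  refine ⟨det_bandMatrix s α A C D, ?_, ?_⟩ <;> rw [hrank] <;>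
    by_cases hx : s * A * D + 1 = 0 <;> by_cases hy : s * α * C + 1 = 0 <;>
    simp_all
end
end
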